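/- Let λ be an eigenvalue of the problem (α,β) and let y be a real-valued eigenfunction for λ. Then the set of eigenvalues of the problem (α,β) that are strictly smaller than λ is finite, and its cardinality equals the number of zeros of y on the open interval (0,1). In particular, if the eigenvalues are enumerated in increasing order as λ_0 < λ_1 < λ_2 < …, then for every n the eigenfunction corresponding to λ_n has exactly n zeros on (0,1). -/

import Mathlib

open Set Filter

/-- First derivative on `[0,1]` (one-sided at the endpoints). -/
noncomputable def Y1 (y : ℝ → ℝ) : ℝ → ℝ := derivWithin y (Set.Icc 0 1)
/-- Second derivative on `[0,1]`. -/
noncomputable def Y2 (y : ℝ → ℝ) : ℝ → ℝ := iteratedDerivWithin 2 y (Set.Icc 0 1)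
/-- Third derivative on `[0,1]`. -/
noncomputable def Y3 (y : ℝ → ℝ) : ℝ → ℝ := iteratedDerivWithin 3 y (Set.Icc 0 1)

/-- `y` is a solution on `[0,1]` of `[y''' - λ P y]' + λ P y' = 0`:
`y ∈ C³[0,1]` and `y''' - λ P y` is (continuously) differentiable on `[0,1]`
with derivative `-λ P y'`. -/
def SolutionOn (P : ℝ → ℝ) (lam : ℝ) (y : ℝ → ℝ) : Prop :=
  ContDiffOn ℝ 3 y (Set.Icc 0 1) ∧
  ∀ x ∈ Set.Icc (0:ℝ) 1,
    HasDerivWithinAt (fun t => Y3 y t - lam * P t * y t)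
      (-(lam * P x * Y1 y x)) (Set.Icc 0 1) x

/-- `y` is not identically zero on `[0,1]`. -/
def Nontrivial01 (y : ℝ → ℝ) : Prop := ∃ x ∈ Set.Icc (0:ℝ) 1, y x ≠ 0

/-- The boundary conditions of the problem `(α, β)`. -/
def BC (α β : ℝ) (y : ℝ → ℝ) : Prop :=
  Y2 y 0 + α * y 0 - β * Y1 y 0 = 0 ∧
  -β * Y3 y 0 + α * Y2 y 0 = 0 ∧
  Y2 y 1 + α * y 1 + β * Y1 y 1 = 0 ∧
  -β * Y3 y 1 - α * Y2 y 1 = 0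

/-- `y` is an eigenfunction of the problem `(α, β)` with eigenvalue `lam`. -/
def Eigenfunction (P : ℝ → ℝ) (α β lam : ℝ) (y : ℝ → ℝ) : Prop :=
  Nontrivial01 y ∧ SolutionOn P lam y ∧ BC α β y

/-- `lam` is an eigenvalue of the problem `(α, β)`. -/
def IsEigenvalue (P : ℝ → ℝ) (α β lam : ℝ) : Prop :=
  ∃ y : ℝ → ℝ, Eigenfunction P α β lam y

/-- The number `b = (1 - κ a)/(κ - 1)`. -/
noncomputable def bb (κ : ℕ) (a : ℝ) : ℝ := (1 - κ * a) / (κ - 1)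

/-- `P` is a nondecreasing continuous function on `[0,1]` with `P 0 = 0`, `P 1 = 1`,
self-similar of Cantor type with parameters `κ ≥ 2` and `0 < a < 1/κ`. -/
def CantorSelfSimilar (P : ℝ → ℝ) (κ : ℕ) (a : ℝ) : Prop :=
  ContinuousOn P (Set.Icc 0 1) ∧ MonotoneOn P (Set.Icc 0 1) ∧
  P 0 = 0 ∧ P 1 = 1 ∧ 2 ≤ κ ∧ 0 < a ∧ a < 1 / κ ∧
  (∀ k : ℕ, k < κ → ∃ c : ℝ, ∀ x ∈ Set.Icc (0:ℝ) 1,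
      (κ : ℝ) * P (k * (a + bb κ a) + a * x) = P x + c) ∧
  (∀ k : ℕ, 1 ≤ k → k < κ →
      ∀ x ∈ Set.Ioo ((k:ℝ) * (a + bb κ a) - bb κ a) ((k:ℝ) * (a + bb κ a)),
      ∀ x' ∈ Set.Ioo ((k:ℝ) * (a + bb κ a) - bb κ a) ((k:ℝ) * (a + bb κ a)),
      P x = P x')

lemma HasDerivWithinAt.of_eq {f g : ℝ → ℝ} {f' g' x : ℝ} {s : Set ℝ}
    (h : HasDerivWithinAt f f' s x) (hfg : ∀ t, g t = f t) (hfg' : g' = f') :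
    HasDerivWithinAt g g' s x := by
  obtain rfl : g = f := funext hfg
  exact hfg' ▸ h

lemma monotoneOn_Icc_of_hasDerivWithinAt_nonneg {f f' : ℝ → ℝ} {a b : ℝ}
    (hf : ∀ x ∈ Icc a b, HasDerivWithinAt f (f' x) (Icc a b) x)
    (hf' : ∀ x ∈ Icc a b, 0 ≤ f' x) : MonotoneOn f (Icc a b) :=
  monotoneOn_of_hasDerivWithinAt_nonneg (convex_Icc a b)
    (fun x hx => (hf x hx).continuousWithinAt)
    (fun x hx => (hf x (interior_subset hx)).mono interior_subset)
    (fun x hx => hf' x (interior_subset hx))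

lemma add_mul_le_of_le_hasDerivWithinAt {f f' : ℝ → ℝ} {a b k : ℝ} (hab : a ≤ b)
    (hf : ∀ x ∈ Icc a b, HasDerivWithinAt f (f' x) (Icc a b) x)
    (hf' : ∀ x ∈ Icc a b, k ≤ f' x) : f a + k * (b - a) ≤ f b := by
  have h := monotoneOn_Icc_of_hasDerivWithinAt_nonneg (f := fun x => f x - k * x)
    (f' := fun x => f' x - k) (a := a) (b := b)
    (fun x hx => ((hf x hx).sub ((hasDerivWithinAt_id x (Icc a b)).const_mul k)).of_eq
      (fun t => by simp) (by simp))
    (fun x hx => sub_nonneg.2 (hf' x hx))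
    (left_mem_Icc.2 hab) (right_mem_Icc.2 hab) hab
  simp only at h
  linarith

/-- If `g - Q f` has derivative `-Q f' + e` with `e ≥ 0`, that is, `dg = f dQ + e dx`, then `g` is
nondecreasing as soon as `f ≥ 0` and `Q` is nondecreasing. -/
lemma monotoneOn_of_stieltjes {Q f f' g e : ℝ → ℝ} {a b : ℝ}
    (hQ : MonotoneOn Q (Icc a b))
    (hf : ∀ x ∈ Icc a b, HasDerivWithinAt f (f' x) (Icc a b) x)
    (hf' : ContinuousOn f' (Icc a b))
    (hg : ∀ x ∈ Icc a b,
      HasDerivWithinAt (fun t => g t - Q t * f t) (-(Q x * f' x) + e x) (Icc a b) x)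
    (he : ∀ x ∈ Icc a b, 0 ≤ e x) (hf0 : ∀ x ∈ Icc a b, 0 ≤ f x) :
    MonotoneOn g (Icc a b) := by
  obtain ⟨C, hC⟩ := isCompact_Icc.exists_bound_of_continuousOn hf'
  have hstep : ∀ u ∈ Icc a b, ∀ v ∈ Icc a b, u ≤ v →
      -(C * (Q v - Q u) * (v - u)) ≤ g v - g u := by
    intro u hu v hv huv
    have hsub : Icc u v ⊆ Icc a b := Icc_subset_Icc hu.1 hv.2
    have hk := add_mul_le_of_le_hasDerivWithinAt
      (f := fun x => (g x - Q x * f x) + Q v * f x)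
      (f' := fun x => (-(Q x * f' x) + e x) + Q v * f' x) (k := -(C * (Q v - Q u))) huv
      (fun x hx => ((hg x (hsub hx)).mono hsub).add (((hf x (hsub hx)).mono hsub).const_mul _))
      (fun x hx => by
        have h1 := hQ hu (hsub hx) hx.1
        have h2 := hQ (hsub hx) hv hx.2
        have h3 := abs_le.1 (Real.norm_eq_abs _ ▸ hC x (hsub hx))
        have h4 := he x (hsub hx)
        have h5 : 0 ≤ C := le_trans (abs_nonneg _) (hC x (hsub hx))
        nlinarith)
    have h6 := mul_nonneg (sub_nonneg.2 (hQ hu hv huv)) (hf0 u hu)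
    nlinarith
  have hhalf : ∀ n : ℕ, ∀ u ∈ Icc a b, ∀ v ∈ Icc a b, u ≤ v →
      -(C * (1 / 2) ^ n * (Q v - Q u) * (v - u)) ≤ g v - g u := by
    intro n
    induction n with
    | zero => simpa using hstep
    | succ n ih =>
      intro u hu v hv huv
      have hm : (u + v) / 2 ∈ Icc a b := ⟨by linarith [hu.1, hv.1], by linarith [hu.2, hv.2]⟩
      have h1 := ih u hu _ hm (by linarith)
      have h2 := ih _ hm v hv (by linarith)
      rw [pow_succ]
      nlinarith
  intro u hu v hv huv
  have hlim : Tendsto (fun n : ℕ => -(C * (1 / 2 : ℝ) ^ n * (Q v - Q u) * (v - u))) atTop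
      (nhds (-(C * 0 * (Q v - Q u) * (v - u)))) :=
    ((((tendsto_pow_atTop_nhds_zero_of_lt_one (by norm_num) (by norm_num)).const_mul
      C).mul_const _).mul_const _).neg
  have := le_of_tendsto hlim (Eventually.of_forall fun n => hhalf n u hu v hv huv)
  simp only [mul_zero, zero_mul, neg_zero] at this
  linarith

lemma mul_le_sub_of_stieltjes {Q f f' g e : ℝ → ℝ} {a b c : ℝ} (hab : a ≤ b)
    (hQ : MonotoneOn Q (Icc a b))
    (hf : ∀ x ∈ Icc a b, HasDerivWithinAt f (f' x) (Icc a b) x)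
    (hf' : ContinuousOn f' (Icc a b))
    (hg : ∀ x ∈ Icc a b,
      HasDerivWithinAt (fun t => g t - Q t * f t) (-(Q x * f' x) + e x) (Icc a b) x)
    (he : ∀ x ∈ Icc a b, 0 ≤ e x) (hfc : ∀ x ∈ Icc a b, c ≤ f x) :
    c * (Q b - Q a) ≤ g b - g a := by
  have h := monotoneOn_of_stieltjes (f := fun x => f x - c) (f' := f')
    (g := fun x => g x - c * Q x) (e := e) hQ (fun x hx => (hf x hx).sub_const c) hf'
    (fun x hx => (hg x hx).of_eq (fun t => by ring) rfl) he
    (fun x hx => sub_nonneg.2 (hfc x hx)) (left_mem_Icc.2 hab) (right_mem_Icc.2 hab) hab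
  linarith

/-- A quantitative version on `[0,1]` with a lower bound that changes at `δ`. -/
lemma lower_bound_of_stieltjes {Q f f' g e : ℝ → ℝ} {c ε δ : ℝ} (hδ : δ ∈ Icc (0 : ℝ) 1)
    (hQ : MonotoneOn Q (Icc 0 1))
    (hf : ∀ x ∈ Icc (0 : ℝ) 1, HasDerivWithinAt f (f' x) (Icc 0 1) x)
    (hf' : ContinuousOn f' (Icc 0 1))
    (hg : ∀ x ∈ Icc (0 : ℝ) 1,
      HasDerivWithinAt (fun t => g t - Q t * f t) (-(Q x * f' x) + e x) (Icc 0 1) x)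
    (he : ∀ x ∈ Icc (0 : ℝ) 1, 0 ≤ e x)
    (hc : ∀ x ∈ Icc 0 δ, c ≤ f x) (hε : ∀ x ∈ Icc (0 : ℝ) 1, -ε ≤ f x) :
    c * (Q δ - Q 0) - ε * (Q 1 - Q δ) ≤ g 1 - g 0 := by
  have hl : Icc 0 δ ⊆ Icc (0 : ℝ) 1 := Icc_subset_Icc le_rfl hδ.2
  have hr : Icc δ 1 ⊆ Icc (0 : ℝ) 1 := Icc_subset_Icc hδ.1 le_rfl
  have h1 := mul_le_sub_of_stieltjes hδ.1 (hQ.mono hl) (fun x hx => (hf x (hl hx)).mono hl)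
    (hf'.mono hl) (fun x hx => (hg x (hl hx)).mono hl) (fun x hx => he x (hl hx)) hc
  have h2 := mul_le_sub_of_stieltjes hδ.2 (hQ.mono hr) (fun x hx => (hf x (hr hx)).mono hr)
    (hf'.mono hr) (fun x hx => (hg x (hr hx)).mono hr) (fun x hx => he x (hr hx))
    (fun x hx => hε x (hr hx))
  linarith

/-! ### The beam equation as a first order system -/

/-- The functions `y 0, y 1, y 2, y 3` are a solution of the beam equation on `[0,1]` together with
its first three derivatives. -/
def IsBeam (P : ℝ → ℝ) (μ : ℝ) (y : Fin 4 → ℝ → ℝ) : Prop :=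
  (∀ x ∈ Icc (0 : ℝ) 1, HasDerivWithinAt (y 0) (y 1 x) (Icc 0 1) x) ∧
  (∀ x ∈ Icc (0 : ℝ) 1, HasDerivWithinAt (y 1) (y 2 x) (Icc 0 1) x) ∧
  (∀ x ∈ Icc (0 : ℝ) 1, HasDerivWithinAt (y 2) (y 3 x) (Icc 0 1) x) ∧
  (∀ x ∈ Icc (0 : ℝ) 1, HasDerivWithinAt (fun t => y 3 t - μ * P t * y 0 t)
      (-(μ * P x * y 1 x)) (Icc 0 1) x)

namespace IsBeam

variable {P : ℝ → ℝ} {μ : ℝ} {y z : Fin 4 → ℝ → ℝ}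

lemma add (hy : IsBeam P μ y) (hz : IsBeam P μ z) : IsBeam P μ (y + z) := by
  obtain ⟨a0, a1, a2, a3⟩ := hy
  obtain ⟨b0, b1, b2, b3⟩ := hz
  refine ⟨fun x hx => (a0 x hx).add (b0 x hx), fun x hx => (a1 x hx).add (b1 x hx),
    fun x hx => (a2 x hx).add (b2 x hx), fun x hx => ((a3 x hx).add (b3 x hx)).of_eq (fun t => ?_) ?_⟩
  all_goals
    simp only [Pi.add_apply]
    ring

lemma const_smul (c : ℝ) (hy : IsBeam P μ y) : IsBeam P μ (c • y) := by
  obtain ⟨a0, a1, a2, a3⟩ := hy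
  refine ⟨fun x hx => (a0 x hx).const_mul c, fun x hx => (a1 x hx).const_mul c,
    fun x hx => (a2 x hx).const_mul c, fun x hx => ((a3 x hx).const_mul c).of_eq (fun t => ?_) ?_⟩
  all_goals
    simp only [Pi.smul_apply, smul_eq_mul]
    ring

lemma neg (hy : IsBeam P μ y) : IsBeam P μ (-y) := by
  simpa using hy.const_smul (-1)

/-- Reflection about the midpoint of `[0,1]`. -/
lemma reflect (hy : IsBeam P μ y) :
    IsBeam (fun x => -P (1 - x)) μ (fun i x => (-1) ^ (i : ℕ) * y i (1 - x)) := by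
  obtain ⟨a0, a1, a2, a3⟩ := hy
  have hmem : ∀ {x : ℝ}, x ∈ Icc (0 : ℝ) 1 → 1 - x ∈ Icc (0 : ℝ) 1 := fun hx =>
    ⟨by linarith [hx.2], by linarith [hx.1]⟩
  have key : ∀ (f : ℝ → ℝ) (f' x : ℝ), x ∈ Icc (0 : ℝ) 1 →
      HasDerivWithinAt f f' (Icc 0 1) (1 - x) →
      HasDerivWithinAt (fun t => f (1 - t)) (-f') (Icc 0 1) x := by
    intro f f' x hx hf
    have := hf.scomp x ((hasDerivWithinAt_id x (Icc (0 : ℝ) 1)).const_sub 1)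
      (fun t ht => hmem ht)
    simpa [Function.comp_def] using this
  refine ⟨fun x hx => (key _ _ x hx (a0 _ (hmem hx))).of_eq (fun t => ?_) ?_,
    fun x hx => (key _ _ x hx (a1 _ (hmem hx))).neg.of_eq (fun t => ?_) ?_,
    fun x hx => (key _ _ x hx (a2 _ (hmem hx))).of_eq (fun t => ?_) ?_,
    fun x hx => (key _ _ x hx (a3 _ (hmem hx))).neg.of_eq (fun t => ?_) ?_⟩
  all_goals
    simp [pow_succ]
    try ring

lemma continuousOn_zero (hy : IsBeam P μ y) : ContinuousOn (y 0) (Icc 0 1) :=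
  fun x hx => (hy.1 x hx).continuousWithinAt

lemma continuousOn_one (hy : IsBeam P μ y) : ContinuousOn (y 1) (Icc 0 1) :=
  fun x hx => (hy.2.1 x hx).continuousWithinAt

lemma mul_le_sub (hP : MonotoneOn P (Icc 0 1)) (hμ : 0 ≤ μ) (hy : IsBeam P μ y) {s t c : ℝ}
    (hs : 0 ≤ s) (hst : s ≤ t) (ht : t ≤ 1) (hc : ∀ x ∈ Icc s t, c ≤ y 0 x) :
    c * (μ * (P t - P s)) ≤ y 3 t - y 3 s := by
  have hsub : Icc s t ⊆ Icc (0 : ℝ) 1 := Icc_subset_Icc hs ht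
  have h := mul_le_sub_of_stieltjes (Q := fun x => μ * P x) (f := y 0) (f' := y 1) (g := y 3)
    (e := fun _ => 0) hst
    (fun u hu v hv huv => mul_le_mul_of_nonneg_left (hP (hsub hu) (hsub hv) huv) hμ)
    (fun x hx => (hy.1 x (hsub hx)).mono hsub) (hy.continuousOn_one.mono hsub)
    (fun x hx => by simpa using (hy.2.2.2 x (hsub hx)).mono hsub) (fun _ _ => le_rfl) hc
  calc c * (μ * (P t - P s)) = c * (μ * P t - μ * P s) := by ring
    _ ≤ _ := h

/-- Nonnegative data propagate to the right over short intervals. -/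
lemma nonneg_of_short (hP : MonotoneOn P (Icc 0 1)) (hP1 : P 1 - P 0 ≤ 1) (hμ : 0 ≤ μ)
    (hy : IsBeam P μ y) {s t : ℝ} (hs : 0 ≤ s) (hst : s ≤ t) (ht : t ≤ 1)
    (hshort : μ * (t - s) ^ 3 < 1) (h0 : ∀ i, 0 ≤ y i s) : ∀ i, 0 ≤ y i t := by
  have hsub : Icc s t ⊆ Icc (0 : ℝ) 1 := Icc_subset_Icc hs ht
  have hftc : ∀ (f f' : ℝ → ℝ) (k : ℝ),
      (∀ x ∈ Icc (0 : ℝ) 1, HasDerivWithinAt f (f' x) (Icc 0 1) x) →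
      (∀ x ∈ Icc s t, k ≤ f' x) → ∀ x ∈ Icc s t, f s + k * (x - s) ≤ f x := by
    intro f f' k hf hk x hx
    have hsx : Icc s x ⊆ Icc s t := Icc_subset_Icc le_rfl hx.2
    exact add_mul_le_of_le_hasDerivWithinAt hx.1
      (fun u hu => (hf u (hsub (hsx hu))).mono (hsx.trans hsub)) (fun u hu => hk u (hsx hu))
  have hall : ∀ m : ℝ, 0 ≤ m → (∀ x ∈ Icc s t, -m ≤ y 0 x) →
      ∀ x ∈ Icc s t, -(m * μ) ≤ y 3 x ∧ -(m * μ * (t - s)) ≤ y 2 x ∧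
        -(m * μ * (t - s) ^ 2) ≤ y 1 x ∧ -(m * μ * (t - s) ^ 3) ≤ y 0 x := by
    intro m hm hlow
    have hmμ : 0 ≤ m * μ := mul_nonneg hm hμ
    have hl : 0 ≤ t - s := sub_nonneg.2 hst
    have e3 : ∀ x ∈ Icc s t, -(m * μ) ≤ y 3 x := by
      intro x hx
      have h := hy.mul_le_sub hP hμ hs hx.1 (hsub hx).2
        (fun u hu => hlow u ⟨hu.1, hu.2.trans hx.2⟩)
      have h1 := hP (hsub hx) (right_mem_Icc.2 zero_le_one) (hsub hx).2
      have h2 := hP (left_mem_Icc.2 zero_le_one) (hsub (left_mem_Icc.2 hst)) hs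
      nlinarith [h0 3]
    have aux : ∀ k : ℝ, 0 ≤ k → ∀ x ∈ Icc s t, -(k * (t - s)) ≤ -k * (x - s) := by
      intro k hk x hx
      nlinarith [hx.2]
    have e2 : ∀ x ∈ Icc s t, -(m * μ * (t - s)) ≤ y 2 x := by
      intro x hx
      have := hftc _ _ _ hy.2.2.1 e3 x hx
      linarith [aux _ hmμ x hx, h0 2]
    have e1 : ∀ x ∈ Icc s t, -(m * μ * (t - s) ^ 2) ≤ y 1 x := by
      intro x hx
      have := hftc _ _ _ hy.2.1 e2 x hx
      have h2 := aux (m * μ * (t - s)) (by positivity) x hx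
      nlinarith [h0 1]
    have e0 : ∀ x ∈ Icc s t, -(m * μ * (t - s) ^ 3) ≤ y 0 x := by
      intro x hx
      have := hftc _ _ _ hy.1 e1 x hx
      have h2 := aux (m * μ * (t - s) ^ 2) (by positivity) x hx
      nlinarith [h0 0]
    exact fun x hx => ⟨e3 x hx, e2 x hx, e1 x hx, e0 x hx⟩
  obtain ⟨x₀, hx₀, hmin⟩ := isCompact_Icc.exists_isMinOn (nonempty_Icc.2 hst)
    (hy.continuousOn_zero.mono hsub)
  have hpos : 0 ≤ y 0 x₀ := by
    by_contra! hneg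
    have h := (hall (-y 0 x₀) (by linarith) (fun x hx => by simpa using hmin hx) x₀ hx₀).2.2.2
    nlinarith
  have h := hall 0 le_rfl (fun x hx => by simpa using hpos.trans (hmin hx)) t
    (right_mem_Icc.2 hst)
  simp only [zero_mul, neg_zero] at h
  intro i
  fin_cases i
  exacts [h.2.2.2, h.2.2.1, h.2.1, h.1]

/-- Nonnegative data propagate to the right. -/
lemma nonneg_right (hP : MonotoneOn P (Icc 0 1)) (hP1 : P 1 - P 0 ≤ 1) (hμ : 0 ≤ μ)
    (hy : IsBeam P μ y) {c : ℝ} (hc : 0 ≤ c) (h0 : ∀ i, 0 ≤ y i c) {x : ℝ} (hx : x ∈ Icc c 1) :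
    ∀ i, 0 ≤ y i x := by
  set l : ℝ := 1 / (μ + 1) with hl
  have hlpos : 0 < l := by positivity
  have hl1 : l ≤ 1 := by rw [hl, div_le_one (by positivity)]; linarith
  have hμl : μ * l < 1 := by rw [hl, mul_one_div, div_lt_one (by positivity)]; linarith
  have key : ∀ n : ℕ, ∀ x ∈ Icc c 1, x ≤ c + n * l → ∀ i, 0 ≤ y i x := by
    intro n
    induction n with
    | zero =>
      intro x hx hxn
      have : x = c := le_antisymm (by simpa using hxn) hx.1
      exact this ▸ h0
    | succ n ih =>
      intro x hx hxn
      have hs := ih (max c (x - l)) ⟨le_max_left _ _, max_le (hx.1.trans hx.2) (by linarith [hx.2])⟩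
        (max_le (by nlinarith [(Nat.cast_nonneg n : (0 : ℝ) ≤ n)]) (by push_cast at hxn; linarith))
      have hle : max c (x - l) ≤ x := max_le hx.1 (by linarith)
      have h1 : 0 ≤ x - max c (x - l) := by linarith
      have h2 : x - max c (x - l) ≤ l := by linarith [le_max_right c (x - l)]
      refine hy.nonneg_of_short hP hP1 hμ (hc.trans (le_max_left _ _)) hle hx.2 ?_ hs
      have h3 : (x - max c (x - l)) ^ 3 ≤ l ^ 3 := pow_le_pow_left₀ h1 h2 3
      have h4 : l ^ 3 ≤ l := by
        calc l ^ 3 ≤ l ^ 1 := pow_le_pow_of_le_one hlpos.le hl1 (by norm_num)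
          _ = l := pow_one l
      nlinarith
  obtain ⟨n, hn⟩ := exists_nat_ge ((x - c) / l)
  exact key n x hx (by rw [div_le_iff₀ hlpos] at hn; linarith)

/-- Nonnegative data, not all of `y', y'', y'''` zero, become strictly positive. -/
lemma pos_right (hP : MonotoneOn P (Icc 0 1)) (hP1 : P 1 - P 0 ≤ 1) (hμ : 0 ≤ μ)
    (hy : IsBeam P μ y) {c : ℝ} (hc : 0 ≤ c) (h0 : ∀ i, 0 ≤ y i c)
    (hne : 0 < y 1 c + y 2 c + y 3 c) {x : ℝ} (hx : x ∈ Ioc c 1) :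
    0 < y 0 x ∧ 0 < y 1 x := by
  have hnn : ∀ {u : ℝ}, u ∈ Icc c 1 → ∀ i, 0 ≤ y i u := fun hu => hy.nonneg_right hP hP1 hμ hc h0 hu
  have hftc : ∀ (f f' : ℝ → ℝ) (k s t : ℝ), s ∈ Icc c 1 → t ∈ Icc c 1 → s ≤ t →
      (∀ x ∈ Icc (0 : ℝ) 1, HasDerivWithinAt f (f' x) (Icc 0 1) x) →
      (∀ x ∈ Icc s t, k ≤ f' x) → f s + k * (t - s) ≤ f t := by
    intro f f' k s t hs ht hst hf hk
    have hsub : Icc s t ⊆ Icc (0 : ℝ) 1 := Icc_subset_Icc (hc.trans hs.1) ht.2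
    exact add_mul_le_of_le_hasDerivWithinAt hst (fun u hu => (hf u (hsub hu)).mono hsub) hk
  have e3 : ∀ u ∈ Icc c 1, y 3 c ≤ y 3 u := by
    intro u hu
    have := hy.mul_le_sub hP hμ hc hu.1 hu.2 (c := 0) (fun v hv => hnn ⟨hv.1, hv.2.trans hu.2⟩ 0)
    linarith
  have hpos1 : ∀ u ∈ Ioc c 1, 0 < y 1 u := by
    intro u hu
    have hcm : c ∈ Icc c 1 := ⟨le_rfl, hu.1.le.trans hu.2⟩
    have hum : u ∈ Icc c 1 := ⟨hu.1.le, hu.2⟩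
    have hm : (c + u) / 2 ∈ Icc c 1 := ⟨by linarith [hu.1], by linarith [hu.2, hu.1]⟩
    have e2 : ∀ v ∈ Icc ((c + u) / 2) u, y 2 c + y 3 c * ((u - c) / 2) ≤ y 2 v := by
      intro v hv
      have hv' : v ∈ Icc c 1 := ⟨hm.1.trans hv.1, hv.2.trans hu.2⟩
      have := hftc _ _ _ c v hcm hv' hv'.1 hy.2.2.1 (fun w hw => e3 w ⟨hw.1, hw.2.trans hv'.2⟩)
      nlinarith [h0 3, hv.1]
    have h1 := hftc _ _ _ _ u hm hum (by linarith [hu.1]) hy.2.1 e2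
    have h2 := hftc _ _ 0 c _ hcm hm hm.1 hy.2.1
      (fun w hw => hnn ⟨hw.1, hw.2.trans hm.2⟩ 2)
    have hd : 0 < u - c := sub_pos.2 hu.1
    have h3 : u - (c + u) / 2 = (u - c) / 2 := by ring
    rw [h3] at h1
    by_contra! hle
    have a1 := h0 1
    have a2 := h0 2
    have a3 := h0 3
    have b1 : 0 ≤ y 2 c * ((u - c) / 2) := by positivity
    have b2 : 0 ≤ y 3 c * ((u - c) / 2) * ((u - c) / 2) := by positivity
    have c1 : y 1 c = 0 := by nlinarith
    have c2 : y 2 c * ((u - c) / 2) = 0 := by nlinarith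
    have c3 : y 3 c * ((u - c) / 2) * ((u - c) / 2) = 0 := by nlinarith
    have d2 : y 2 c = 0 := by
      rcases mul_eq_zero.1 c2 with h | h
      · exact h
      · linarith
    have d3 : y 3 c = 0 := by
      rcases mul_eq_zero.1 c3 with h | h
      · rcases mul_eq_zero.1 h with h | h
        · exact h
        · linarith
      · linarith
    linarith
  refine ⟨?_, hpos1 x hx⟩
  have hxm : x ∈ Icc c 1 := ⟨hx.1.le, hx.2⟩
  have hm : (c + x) / 2 ∈ Ioc c 1 := ⟨by linarith [hx.1], by linarith [hx.2, hx.1]⟩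
  have hm' : (c + x) / 2 ∈ Icc c 1 := ⟨hm.1.le, hm.2⟩
  have h1 : ∀ v ∈ Icc ((c + x) / 2) x, y 1 ((c + x) / 2) ≤ y 1 v := by
    intro v hv
    have hv' : v ∈ Icc c 1 := ⟨hm.1.le.trans hv.1, hv.2.trans hx.2⟩
    have := hftc _ _ 0 _ v hm' hv' hv.1 hy.2.1
      (fun w hw => hnn ⟨hm'.1.trans hw.1, hw.2.trans hv'.2⟩ 2)
    linarith
  have h2 := hftc _ _ _ _ x hm' hxm (by linarith [hx.1]) hy.1 h1
  have h3 := hpos1 _ hm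
  have h4 := hnn hm' 0
  have h5 : 0 < x - (c + x) / 2 := by linarith [hx.1]
  nlinarith [mul_pos h3 h5]

lemma monotoneOn_reflect (hP : MonotoneOn P (Icc 0 1)) :
    MonotoneOn (fun x => -P (1 - x)) (Icc 0 1) := fun u hu v hv huv =>
  neg_le_neg (hP ⟨by linarith [hv.2], by linarith [hv.1]⟩ ⟨by linarith [hu.2], by linarith [hu.1]⟩
    (by linarith))

/-- Data with alternating signs propagate to the left. -/
lemma alternating_left (hP : MonotoneOn P (Icc 0 1)) (hP1 : P 1 - P 0 ≤ 1) (hμ : 0 ≤ μ)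
    (hy : IsBeam P μ y) {c : ℝ} (hc : c ≤ 1) (h0 : 0 ≤ y 0 c) (h1 : y 1 c ≤ 0) (h2 : 0 ≤ y 2 c)
    (h3 : y 3 c ≤ 0) {x : ℝ} (hx : x ∈ Icc 0 c) :
    0 ≤ y 0 x ∧ y 1 x ≤ 0 ∧ 0 ≤ y 2 x ∧ y 3 x ≤ 0 := by
  have h := hy.reflect.nonneg_right (monotoneOn_reflect hP) (by norm_num; linarith) hμ
    (c := 1 - c) (by linarith)
    (fun i => by fin_cases i <;> norm_num [pow_succ] <;> assumption)
    (x := 1 - x) ⟨by linarith [hx.2], by linarith [hx.1]⟩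
  have := h 0
  have := h 1
  have := h 2
  have := h 3
  norm_num [pow_succ] at *
  tauto

lemma alternating_left_strict (hP : MonotoneOn P (Icc 0 1)) (hP1 : P 1 - P 0 ≤ 1) (hμ : 0 ≤ μ)
    (hy : IsBeam P μ y) {c : ℝ} (hc : c ≤ 1) (h0 : 0 ≤ y 0 c) (h1 : y 1 c ≤ 0) (h2 : 0 ≤ y 2 c)
    (h3 : y 3 c ≤ 0) (hne : 0 < -y 1 c + y 2 c - y 3 c) {x : ℝ} (hx : x ∈ Ico 0 c) :
    0 < y 0 x ∧ y 1 x < 0 := by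
  have h := hy.reflect.pos_right (monotoneOn_reflect hP) (by norm_num; linarith) hμ
    (c := 1 - c) (by linarith)
    (fun i => by fin_cases i <;> norm_num [pow_succ] <;> assumption)
    (by norm_num [pow_succ]; linarith)
    (x := 1 - x) ⟨by linarith [hx.2], by linarith [hx.1]⟩
  norm_num [pow_succ] at h
  exact h

end IsBeam

/-! ### Existence, uniqueness and continuous dependence on the spectral parameter -/

/-- The vector field of the first order system for `(y, y', y'', y''' - μ P y)`. -/
def beamField (P : ℝ → ℝ) (μ t : ℝ) (x : Fin 4 → ℝ) : Fin 4 → ℝ :=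
  ![x 1, x 2, x 3 + μ * P t * x 0, -(μ * P t * x 1)]

lemma beamField_sub (P : ℝ → ℝ) (μ t : ℝ) (x x' : Fin 4 → ℝ) :
    beamField P μ t x - beamField P μ t x' = beamField P μ t (x - x') := by
  funext i
  fin_cases i <;> simp [beamField] <;> ring

lemma abs_mul_mul_le {p m v N : ℝ} (hp : |p| ≤ 1) (hv : |v| ≤ N) : |m * p * v| ≤ |m| * N := by
  rw [abs_mul, abs_mul]
  have h1 : |p| * |v| ≤ 1 * N := mul_le_mul hp hv (abs_nonneg _) zero_le_one
  nlinarith [abs_nonneg m]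

lemma norm_beamField_le {P : ℝ → ℝ} {t : ℝ} (hP : |P t| ≤ 1) (μ : ℝ) (x : Fin 4 → ℝ) :
    ‖beamField P μ t x‖ ≤ (1 + |μ|) * ‖x‖ := by
  have hx : ∀ i, |x i| ≤ ‖x‖ := fun i => norm_le_pi_norm x i
  have hm := mul_nonneg (abs_nonneg μ) (norm_nonneg x)
  have h0 := abs_mul_mul_le (m := μ) hP (hx 0)
  have h1 := abs_mul_mul_le (m := μ) hP (hx 1)
  refine (pi_norm_le_iff_of_nonneg (by positivity)).2 fun i => ?_
  rw [Real.norm_eq_abs]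
  fin_cases i <;> simp only [beamField]
  · exact (hx 1).trans (by linarith)
  · exact (hx 2).trans (by linarith)
  · exact (abs_add_le _ _).trans (by linarith [hx 3])
  · exact (abs_neg _).trans_le (h1.trans (by linarith [norm_nonneg x]))

lemma continuousOn_beamField {P : ℝ → ℝ} {s : Set ℝ} (hP : ContinuousOn P s) (μ : ℝ)
    (x : Fin 4 → ℝ) : ContinuousOn (fun t => beamField P μ t x) s := by
  refine continuousOn_pi.2 fun i => ?_
  fin_cases i <;> simp only [beamField] <;> dsimp <;> fun_prop

lemma exists_beamField_solution {P : ℝ → ℝ} (hPc : ContinuousOn P (Icc 0 1))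
    (hP : ∀ t ∈ Icc (0 : ℝ) 1, |P t| ≤ 1) (μ : ℝ) (x₀ : Fin 4 → ℝ) :
    ∃ X : ℝ → Fin 4 → ℝ, X 0 = x₀ ∧ ∀ t ∈ Icc (0 : ℝ) 1,
      HasDerivWithinAt X (beamField P μ t (X t)) (Icc 0 1) t := by
  set K : ℝ := 1 + |μ| with hK
  have hK0 : 0 ≤ K := by positivity
  set R : ℝ := ‖x₀‖ * Real.exp K with hR
  have hR0 : 0 ≤ R := by positivity
  -- the field is truncated so that it becomes bounded
  set clip : (Fin 4 → ℝ) → Fin 4 → ℝ := fun x i => max (-R) (min R (x i)) with hclip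
  have hclipR : ∀ x, ‖clip x‖ ≤ R := fun x => (pi_norm_le_iff_of_nonneg hR0).2 fun i =>
    abs_le.2 ⟨le_max_left _ _, max_le (by linarith) (min_le_left _ _)⟩
  have hclipsub : ∀ x x', ‖clip x - clip x'‖ ≤ ‖x - x'‖ := fun x x' =>
    (pi_norm_le_iff_of_nonneg (norm_nonneg _)).2 fun i => by
      have h1 : |clip x i - clip x' i| ≤ |x i - x' i| := by
        simp only [hclip]
        refine (abs_max_sub_max_le_max _ _ _ _).trans ?_
        rw [sub_self, abs_zero, max_eq_right (abs_nonneg _)]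
        refine (abs_min_sub_min_le_max _ _ _ _).trans ?_
        rw [sub_self, abs_zero, max_eq_right (abs_nonneg _)]
      exact h1.trans (norm_le_pi_norm (x - x') i)
  have hclipid : ∀ x, ‖x‖ ≤ R → clip x = x := fun x hx => by
    funext i
    have := abs_le.1 ((norm_le_pi_norm x i).trans hx)
    simp only [hclip]
    rw [min_eq_right this.2, max_eq_right this.1]
  have hclip0 : ∀ x, ‖clip x‖ ≤ ‖x‖ := fun x => by
    simpa [hclipid 0 (by simpa using hR0)] using hclipsub x 0
  have hPL : IsPicardLindelof (fun t x => beamField P μ t (clip x))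
      (⟨0, by simp⟩ : Icc (0 : ℝ) 1) x₀ ⟨K * R, by positivity⟩ 0 ⟨K * R, by positivity⟩
      ⟨K, hK0⟩ := by
    refine ⟨fun t ht => LipschitzOnWith.of_dist_le_mul fun x _ x' _ => ?_,
      fun x _ => continuousOn_beamField hPc μ _, fun t ht x _ => ?_, ?_⟩
    · rw [dist_eq_norm, dist_eq_norm, beamField_sub]
      exact (norm_beamField_le (hP t ht) μ _).trans
        (mul_le_mul_of_nonneg_left (hclipsub x x') hK0)
    · exact (norm_beamField_le (hP t ht) μ _).trans
        (mul_le_mul_of_nonneg_left (hclipR x) hK0)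
    · simp
  obtain ⟨X, hX0, hX⟩ := hPL.exists_eq_forall_mem_Icc_hasDerivWithinAt₀
  refine ⟨X, hX0, fun t ht => ?_⟩
  have hbound := norm_le_gronwallBound_of_norm_deriv_right_le (f := X) (δ := ‖x₀‖) (K := K) (ε := 0)
    (fun t ht => (hX t ht).continuousWithinAt)
    (fun t ht => (hX t ⟨ht.1, ht.2.le⟩).mono_of_mem_nhdsWithin (Icc_mem_nhdsGE_of_mem ht))
    (by simpa using (congrArg norm hX0).le)
    (fun t ht => by
      rw [add_zero]
      exact (norm_beamField_le (hP t ⟨ht.1, ht.2.le⟩) μ _).trans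
        (mul_le_mul_of_nonneg_left (hclip0 _) hK0)) t ht
  rw [gronwallBound_ε0, sub_zero] at hbound
  have hle : ‖X t‖ ≤ R := hbound.trans (mul_le_mul_of_nonneg_left
    (Real.exp_le_exp.2 (by nlinarith [ht.2])) (norm_nonneg _))
  simpa only [hclipid _ hle] using hX t ht

lemma IsBeam.hasDerivWithinAt_system {P : ℝ → ℝ} {μ : ℝ} {y : Fin 4 → ℝ → ℝ} (hy : IsBeam P μ y)
    {t : ℝ} (ht : t ∈ Icc (0 : ℝ) 1) :
    HasDerivWithinAt (fun t => ![y 0 t, y 1 t, y 2 t, y 3 t - μ * P t * y 0 t])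
      (beamField P μ t ![y 0 t, y 1 t, y 2 t, y 3 t - μ * P t * y 0 t]) (Icc 0 1) t := by
  refine hasDerivWithinAt_pi.2 fun i => ?_
  fin_cases i <;> simp [beamField]
  exacts [hy.1 t ht, hy.2.1 t ht, hy.2.2.1 t ht, hy.2.2.2 t ht]

lemma isBeam_of_system {P : ℝ → ℝ} {μ : ℝ} {X : ℝ → Fin 4 → ℝ}
    (hX : ∀ t ∈ Icc (0 : ℝ) 1, HasDerivWithinAt X (beamField P μ t (X t)) (Icc 0 1) t) :
    IsBeam P μ ![fun t => X t 0, fun t => X t 1, fun t => X t 2,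
      fun t => X t 3 + μ * P t * X t 0] := by
  have h : ∀ t ∈ Icc (0 : ℝ) 1, ∀ i, HasDerivWithinAt (fun t => X t i)
      (beamField P μ t (X t) i) (Icc 0 1) t := fun t ht => hasDerivWithinAt_pi.1 (hX t ht)
  refine ⟨fun t ht => h t ht 0, fun t ht => h t ht 1, fun t ht => h t ht 2, fun t ht => ?_⟩
  exact (h t ht 3).of_eq (fun t => by simp) rfl

/-- A solution with zero initial data vanishes. -/
lemma IsBeam.eq_zero {P : ℝ → ℝ} (hP : ∀ t ∈ Icc (0 : ℝ) 1, |P t| ≤ 1) {μ : ℝ}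
    {y : Fin 4 → ℝ → ℝ} (hy : IsBeam P μ y) (h0 : ∀ i, y i 0 = 0) {t : ℝ}
    (ht : t ∈ Icc (0 : ℝ) 1) (i : Fin 4) : y i t = 0 := by
  have h := eq_zero_of_abs_deriv_le_mul_abs_self_of_eq_zero_right (K := 1 + |μ|)
    (fun t ht => (hy.hasDerivWithinAt_system ht).continuousWithinAt)
    (fun t ht => (hy.hasDerivWithinAt_system ⟨ht.1, ht.2.le⟩).mono_of_mem_nhdsWithin
      (Icc_mem_nhdsGE_of_mem ht))
    (by
      funext i
      fin_cases i <;> simp [h0])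
    (fun t ht => norm_beamField_le (hP t ⟨ht.1, ht.2.le⟩) μ _) t ht
  have e0 : y 0 t = 0 := congrFun h 0
  have e3 : y 3 t - μ * P t * y 0 t = 0 := congrFun h 3
  fin_cases i
  exacts [e0, congrFun h 1, congrFun h 2, by simpa [e0] using e3]

/-- Continuity at `μ₀` of a family of functions, uniformly on `[0,1]`. -/
def UnifContAt (Y : ℝ → Fin 4 → ℝ → ℝ) (μ₀ : ℝ) : Prop :=
  ∃ M : ℝ → ℝ, Tendsto M (nhds μ₀) (nhds 0) ∧
    ∀ μ, ∀ x ∈ Icc (0 : ℝ) 1, ∀ i, |Y μ i x - Y μ₀ i x| ≤ M μ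

lemma UnifContAt.continuousAt {Y : ℝ → Fin 4 → ℝ → ℝ} {μ₀ : ℝ} (h : UnifContAt Y μ₀) (i : Fin 4)
    {x : ℝ} (hx : x ∈ Icc (0 : ℝ) 1) : ContinuousAt (fun μ => Y μ i x) μ₀ := by
  obtain ⟨M, hM, hY⟩ := h
  exact tendsto_iff_dist_tendsto_zero.2 (squeeze_zero (fun _ => dist_nonneg)
    (fun μ => (Real.dist_eq _ _).trans_le (hY μ x hx i)) hM)

lemma exists_beam_family {P : ℝ → ℝ} (hPc : ContinuousOn P (Icc 0 1))
    (hP : ∀ t ∈ Icc (0 : ℝ) 1, |P t| ≤ 1) (hP0 : P 0 = 0) (d : Fin 4 → ℝ) :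
    ∃ U : ℝ → Fin 4 → ℝ → ℝ, (∀ μ, IsBeam P μ (U μ)) ∧ (∀ μ i, U μ i 0 = d i) ∧
      ∀ μ₀, UnifContAt U μ₀ := by
  choose X hX0 hX using fun μ => exists_beamField_solution hPc hP μ d
  refine ⟨fun μ => ![fun t => X μ t 0, fun t => X μ t 1, fun t => X μ t 2,
      fun t => X μ t 3 + μ * P t * X μ t 0], fun μ => isBeam_of_system (hX μ), fun μ i => ?_,
      fun μ₀ => ?_⟩
  · fin_cases i <;> simp [hX0, hP0]
  obtain ⟨B, hB⟩ := isCompact_Icc.exists_bound_of_continuousOn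
    (fun t ht => (hX μ₀ t ht).continuousWithinAt)
  set M : ℝ → ℝ := fun μ => gronwallBound 0 (1 + |μ|) (|μ - μ₀| * B) 1 with hMdef
  have hMcont : Tendsto M (nhds μ₀) (nhds 0) := by
    have hc : Continuous M := by
      have : M = fun μ => 0 * Real.exp ((1 + |μ|) * 1) +
          |μ - μ₀| * B / (1 + |μ|) * (Real.exp ((1 + |μ|) * 1) - 1) := by
        funext μ
        simp only [hMdef]
        rw [gronwallBound_of_K_ne_0 (by positivity)]
      rw [this]
      have h1 : ∀ μ : ℝ, 1 + |μ| ≠ 0 := fun μ => by positivity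
      fun_prop (disch := exact h1 _)
    have h0 : M μ₀ = 0 := by simp [hMdef, gronwallBound_ε0_δ0]
    exact h0 ▸ hc.tendsto μ₀
  have hB0 : 0 ≤ B := (norm_nonneg _).trans (hB 0 (by simp))
  have hmain : ∀ μ, ∀ t ∈ Icc (0 : ℝ) 1, ‖X μ t - X μ₀ t‖ ≤ M μ := by
    intro μ t ht
    have h := norm_le_gronwallBound_of_norm_deriv_right_le (f := fun t => X μ t - X μ₀ t)
      (δ := 0) (K := 1 + |μ|) (ε := |μ - μ₀| * B)
      (fun t ht => ((hX μ t ht).sub (hX μ₀ t ht)).continuousWithinAt)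
      (fun t ht => ((hX μ t ⟨ht.1, ht.2.le⟩).sub
        (hX μ₀ t ⟨ht.1, ht.2.le⟩)).mono_of_mem_nhdsWithin (Icc_mem_nhdsGE_of_mem ht))
      (by simp [hX0])
      (fun t ht => by
        have ht' : t ∈ Icc (0 : ℝ) 1 := ⟨ht.1, ht.2.le⟩
        have e : beamField P μ t (X μ t) - beamField P μ₀ t (X μ₀ t) =
            beamField P μ t (X μ t - X μ₀ t) +
              ![0, 0, (μ - μ₀) * P t * X μ₀ t 0, -((μ - μ₀) * P t * X μ₀ t 1)] := by
          funext i
          fin_cases i <;> simp [beamField] <;> ring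
        rw [e]
        refine (norm_add_le _ _).trans (add_le_add (norm_beamField_le (hP t ht') μ _) ?_)
        have hv : ∀ i, |X μ₀ t i| ≤ B := fun i => (norm_le_pi_norm _ i).trans (hB t ht')
        refine (pi_norm_le_iff_of_nonneg (by positivity)).2 fun i => ?_
        rw [Real.norm_eq_abs]
        fin_cases i
        · simpa using mul_nonneg (abs_nonneg _) hB0
        · simpa using mul_nonneg (abs_nonneg _) hB0
        · exact abs_mul_mul_le (hP t ht') (hv 0)
        · exact (abs_neg _).trans_le (abs_mul_mul_le (hP t ht') (hv 1))) t ht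
    rw [sub_zero] at h
    exact h.trans (gronwallBound_mono le_rfl (by positivity) (by positivity) ht.2)
  refine ⟨fun μ => (1 + |μ|) * M μ + |μ - μ₀| * B, ?_, fun μ t ht => ?_⟩
  · have h1 : Tendsto (fun μ : ℝ => (1 + |μ|) * M μ + |μ - μ₀| * B) (nhds μ₀)
        (nhds ((1 + |μ₀|) * 0 + |μ₀ - μ₀| * B)) :=
      ((Continuous.tendsto (by fun_prop) μ₀).mul hMcont).add
        (Continuous.tendsto (by fun_prop) μ₀)
    simpa using h1
  · have hcomp : ∀ i, |X μ t i - X μ₀ t i| ≤ M μ := fun i =>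
      (norm_le_pi_norm (X μ t - X μ₀ t) i).trans (hmain μ t ht)
    have hM0 : 0 ≤ M μ := (abs_nonneg _).trans (hcomp 0)
    have hle : M μ ≤ (1 + |μ|) * M μ + |μ - μ₀| * B := by
      nlinarith [mul_nonneg (abs_nonneg μ) hM0, mul_nonneg (abs_nonneg (μ - μ₀)) hB0]
    intro i
    fin_cases i
    · exact (hcomp 0).trans hle
    · exact (hcomp 1).trans hle
    · exact (hcomp 2).trans hle
    · have e : (X μ t 3 + μ * P t * X μ t 0) - (X μ₀ t 3 + μ₀ * P t * X μ₀ t 0) =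
          (X μ t 3 - X μ₀ t 3) + (μ * P t * (X μ t 0 - X μ₀ t 0) +
            (μ - μ₀) * P t * X μ₀ t 0) := by ring
      have h1 := abs_mul_mul_le (m := μ) (hP t ht) (hcomp 0)
      have h2 := abs_mul_mul_le (m := μ - μ₀) (hP t ht)
        ((norm_le_pi_norm (X μ₀ t) 0).trans (hB t ht))
      change |(X μ t 3 + μ * P t * X μ t 0) - (X μ₀ t 3 + μ₀ * P t * X μ₀ t 0)| ≤ _
      rw [e]
      refine (abs_add_le _ _).trans ?_
      have := (abs_add_le (μ * P t * (X μ t 0 - X μ₀ t 0)) ((μ - μ₀) * P t * X μ₀ t 0))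
      linarith [hcomp 3]

/-! ### Boundary conditions and simplicity of zeros -/

/-- The measure-generating functions that are considered: continuous and nondecreasing on `[0,1]`,
with `P 0 = 0`, `P 1 = 1` and `P` positive on `(0,1]`. -/
structure IsWeight (P : ℝ → ℝ) : Prop where
  cont : ContinuousOn P (Icc 0 1)
  mono : MonotoneOn P (Icc 0 1)
  zero : P 0 = 0
  one : P 1 = 1
  pos : ∀ x ∈ Ioc (0 : ℝ) 1, 0 < P x

lemma IsWeight.abs_le_one {P : ℝ → ℝ} (hP : IsWeight P) {t : ℝ} (ht : t ∈ Icc (0 : ℝ) 1) :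
    |P t| ≤ 1 := by
  have h0 := hP.mono (left_mem_Icc.2 zero_le_one) ht ht.1
  have h1 := hP.mono ht (right_mem_Icc.2 zero_le_one) ht.2
  rw [hP.zero] at h0
  rw [hP.one] at h1
  exact abs_le.2 ⟨by linarith, h1⟩

lemma IsWeight.sub_le_one {P : ℝ → ℝ} (hP : IsWeight P) : P 1 - P 0 ≤ 1 := by
  rw [hP.zero, hP.one, sub_zero]

lemma CantorSelfSimilar.isWeight {P : ℝ → ℝ} {κ : ℕ} {a : ℝ} (h : CantorSelfSimilar P κ a) :
    IsWeight P := by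
  obtain ⟨hc, hm, h0, h1, hκ, ha, haκ, hs, -⟩ := h
  refine ⟨hc, hm, h0, h1, fun x hx => ?_⟩
  have hκ' : (2 : ℝ) ≤ κ := by exact_mod_cast hκ
  have ha1 : a < 1 := haκ.trans_le ((div_le_one (by linarith)).2 (by linarith))
  obtain ⟨c, hc'⟩ := hs 0 (by omega)
  have hc0 : c = 0 := by simpa [h0] using (hc' 0 (by simp)).symm
  subst hc0
  have hpow : ∀ n : ℕ, 0 < P (a ^ n) := by
    intro n
    induction n with
    | zero => simp [h1]
    | succ n ih =>
      have h2 := hc' (a ^ n) ⟨by positivity, pow_le_one₀ ha.le ha1.le⟩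
      simp only [Nat.cast_zero, zero_mul, zero_add, add_zero] at h2
      rw [pow_succ']
      exact pos_of_mul_pos_right (h2 ▸ ih) (by linarith)
  obtain ⟨n, hn⟩ := exists_pow_lt_of_lt_one hx.1 ha1
  exact (hpow n).trans_le
    (hm ⟨by positivity, pow_le_one₀ ha.le ha1.le⟩ ⟨hx.1.le, hx.2⟩ hn.le)

/-- The two boundary conditions at `0`. -/
def LeftBC (α β : ℝ) (y : Fin 4 → ℝ → ℝ) : Prop :=
  y 2 0 + α * y 0 0 - β * y 1 0 = 0 ∧ -β * y 3 0 + α * y 2 0 = 0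

/-- The expression in the first boundary condition at `1`. -/
def bForm (α β : ℝ) (y : Fin 4 → ℝ → ℝ) : ℝ := y 2 1 + α * y 0 1 + β * y 1 1

/-- The expression in the second boundary condition at `1`, up to sign. -/
def gForm (α β : ℝ) (y : Fin 4 → ℝ → ℝ) : ℝ := β * y 3 1 + α * y 2 1

lemma LeftBC.neg {α β : ℝ} {y : Fin 4 → ℝ → ℝ} (h : LeftBC α β y) : LeftBC α β (-y) := by
  obtain ⟨h1, h2⟩ := h
  constructor
  all_goals
    simp only [Pi.neg_apply]
    linarith

lemma bForm_neg (α β : ℝ) (y : Fin 4 → ℝ → ℝ) : bForm α β (-y) = -bForm α β y := by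
  simp only [bForm, Pi.neg_apply]
  ring

lemma gForm_neg (α β : ℝ) (y : Fin 4 → ℝ → ℝ) : gForm α β (-y) = -gForm α β y := by
  simp only [gForm, Pi.neg_apply]
  ring

namespace IsBeam

variable {P : ℝ → ℝ} {α β μ : ℝ} {y : Fin 4 → ℝ → ℝ}

lemma not_alternating (hP : IsWeight P) (hα : 0 ≤ α) (hβ : 0 < β) (hμ : 0 ≤ μ)
    (hy : IsBeam P μ y) (hL : LeftBC α β y) {c : ℝ} (hc : c ∈ Ioc (0 : ℝ) 1) (h0 : 0 ≤ y 0 c)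
    (h1 : y 1 c ≤ 0) (h2 : 0 ≤ y 2 c) (h3 : y 3 c ≤ 0) : ¬ 0 < -y 1 c + y 2 c - y 3 c := by
  intro hne
  obtain ⟨a0, a1⟩ := hy.alternating_left_strict hP.mono hP.sub_le_one hμ hc.2 h0 h1 h2 h3 hne
    (x := 0) ⟨le_rfl, hc.1⟩
  have a2 := (hy.alternating_left hP.mono hP.sub_le_one hμ hc.2 h0 h1 h2 h3 (x := 0)
    ⟨le_rfl, hc.1.le⟩).2.2.1
  have := hL.1
  nlinarith [mul_nonneg hα a0.le]

lemma not_double_zero_aux (hP : IsWeight P) (hα : 0 ≤ α) (hβ : 0 < β) (hμ : 0 ≤ μ)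
    (hy : IsBeam P μ y) (hL : LeftBC α β y) (hB : bForm α β y = 0) (h00 : y 0 0 ≠ 0) {c : ℝ}
    (hc : c ∈ Ioc (0 : ℝ) 1) (h0 : y 0 c = 0) (h1 : y 1 c = 0) (h2 : 0 ≤ y 2 c) : False := by
  rcases le_or_gt (y 3 c) 0 with h3 | h3
  · by_cases hne : 0 < -y 1 c + y 2 c - y 3 c
    · exact hy.not_alternating hP hα hβ hμ hL hc h0.ge h1.le h2 h3 hne
    · have e2 : y 2 c = 0 := by linarith
      have e3 : y 3 c = 0 := by linarith
      have a := (hy.alternating_left hP.mono hP.sub_le_one hμ hc.2 h0.ge h1.le h2 h3 (x := 0)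
        ⟨le_rfl, hc.1.le⟩).1
      have b := (hy.neg.alternating_left hP.mono hP.sub_le_one hμ hc.2 (by simp [h0]) (by simp [h1])
        (by simp [e2]) (by simp [e3]) (x := 0) ⟨le_rfl, hc.1.le⟩).1
      simp only [Pi.neg_apply] at b
      exact h00 (by linarith)
  · rcases hc.2.lt_or_eq with hlt | rfl
    · have hnn : ∀ i, 0 ≤ y i c := by
        intro i
        fin_cases i
        exacts [h0.ge, h1.ge, h2, h3.le]
      have h1' : (1 : ℝ) ∈ Ioc c 1 := ⟨hlt, le_rfl⟩
      obtain ⟨a0, a1⟩ := hy.pos_right hP.mono hP.sub_le_one hμ hc.1.le hnn (by linarith) h1'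
      have a2 := hy.nonneg_right hP.mono hP.sub_le_one hμ hc.1.le hnn ⟨h1'.1.le, le_rfl⟩ 2
      unfold bForm at hB
      nlinarith [mul_nonneg hα a0.le]
    · have e2 : y 2 1 = 0 := by simpa [bForm, h0, h1] using hB
      exact hy.neg.not_alternating hP hα hβ hμ hL.neg hc (by simp [h0]) (by simp [h1])
        (by simp [e2]) (by simpa using h3.le) (by simpa [h1, e2] using h3)

/-- Zeros of a nontrivial solution that satisfies three of the boundary conditions are simple. -/
lemma not_double_zero (hP : IsWeight P) (hα : 0 ≤ α) (hβ : 0 < β) (hμ : 0 ≤ μ)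
    (hy : IsBeam P μ y) (hL : LeftBC α β y) (hB : bForm α β y = 0) (h00 : y 0 0 ≠ 0) {c : ℝ}
    (hc : c ∈ Ioc (0 : ℝ) 1) (h0 : y 0 c = 0) (h1 : y 1 c = 0) : False := by
  rcases le_total 0 (y 2 c) with h2 | h2
  · exact not_double_zero_aux hP hα hβ hμ hy hL hB h00 hc h0 h1 h2
  · exact not_double_zero_aux hP hα hβ hμ hy.neg hL.neg (by rw [bForm_neg, hB, neg_zero])
      (by simpa using h00) hc (by simp [h0]) (by simp [h1]) (by simpa using h2)

lemma gForm_pos_of_neg (hP : IsWeight P) (hα : 0 ≤ α) (hβ : 0 < β) (hμ : 0 ≤ μ)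
    (hy : IsBeam P μ y) (hL : LeftBC α β y) (hB : bForm α β y = 0)
    (h0 : y 0 1 = 0) (h1 : y 1 1 < 0) : 0 < gForm α β y := by
  have h2 : y 2 1 = -β * y 1 1 := by
    unfold bForm at hB
    rw [h0] at hB
    linarith
  have h2' : 0 < y 2 1 := by nlinarith
  have h3 : 0 < y 3 1 := by
    by_contra! h3
    exact hy.not_alternating hP hα hβ hμ hL ⟨zero_lt_one, le_rfl⟩ h0.ge h1.le h2'.le h3
      (by linarith)
  unfold gForm
  positivity

/-- At a zero at the right endpoint, `gForm` and the derivative have opposite signs. -/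
lemma gForm_mul_neg (hP : IsWeight P) (hα : 0 ≤ α) (hβ : 0 < β) (hμ : 0 ≤ μ)
    (hy : IsBeam P μ y) (hL : LeftBC α β y) (hB : bForm α β y = 0) (h00 : y 0 0 ≠ 0)
    (h0 : y 0 1 = 0) : gForm α β y * y 1 1 < 0 := by
  rcases lt_trichotomy (y 1 1) 0 with h1 | h1 | h1
  · exact mul_neg_of_pos_of_neg (gForm_pos_of_neg hP hα hβ hμ hy hL hB h0 h1) h1
  · exact (hy.not_double_zero hP hα hβ hμ hL hB h00 ⟨zero_lt_one, le_rfl⟩ h0 h1).elim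
  · have h := gForm_pos_of_neg hP hα hβ hμ hy.neg hL.neg (by rw [bForm_neg, hB, neg_zero])
      (by simp [h0]) (by simpa using h1)
    rw [gForm_neg] at h
    nlinarith

end IsBeam

/-! ### The Lagrange identity and positivity of the spectrum -/

namespace IsBeam

variable {P : ℝ → ℝ} {α β μ ν : ℝ} {y z : Fin 4 → ℝ → ℝ}

lemma hasDerivWithinAt_mul (hy : IsBeam P μ y) (hz : IsBeam P ν z) {x : ℝ}
    (hx : x ∈ Icc (0 : ℝ) 1) :
    HasDerivWithinAt (fun t => y 0 t * z 0 t) (y 1 x * z 0 x + y 0 x * z 1 x) (Icc 0 1) x :=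
  (hy.1 x hx).mul (hz.1 x hx)

lemma hasDerivWithinAt_lagrange (hy : IsBeam P μ y) (hz : IsBeam P ν z) {x : ℝ}
    (hx : x ∈ Icc (0 : ℝ) 1) :
    HasDerivWithinAt
      (fun t => (y 3 t * z 0 t - y 2 t * z 1 t + y 1 t * z 2 t - y 0 t * z 3 t) -
        (μ - ν) * P t * (y 0 t * z 0 t))
      (-((μ - ν) * P x * (y 1 x * z 0 x + y 0 x * z 1 x))) (Icc 0 1) x := by
  obtain ⟨a0, a1, a2, a3⟩ := hy
  obtain ⟨b0, b1, b2, b3⟩ := hz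
  exact (((((a3 x hx).mul (b0 x hx)).sub ((a2 x hx).mul (b1 x hx))).add
    ((a1 x hx).mul (b2 x hx))).sub ((a0 x hx).mul (b3 x hx))).of_eq
      (fun t => by simp only [Pi.mul_apply, Pi.sub_apply, Pi.add_apply]; ring) (by ring)

lemma lower_bound_lagrange (hP : IsWeight P) (hβ : 0 < β) (hy : IsBeam P μ y) (hz : IsBeam P ν z)
    (hyL : LeftBC α β y) (hzL : LeftBC α β z) (hyB : bForm α β y = 0) (hzB : bForm α β z = 0)
    (hne : μ ≠ ν) {c ε δ : ℝ} (hδ : δ ∈ Icc (0 : ℝ) 1) (hc : ∀ x ∈ Icc 0 δ, c ≤ y 0 x * z 0 x)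
    (hε : ∀ x ∈ Icc (0 : ℝ) 1, -ε ≤ y 0 x * z 0 x) :
    β * (c * P δ - ε * (1 - P δ)) ≤
      (z 0 1 * gForm α β y - y 0 1 * gForm α β z) / (μ - ν) := by
  have hne' : μ - ν ≠ 0 := sub_ne_zero.2 hne
  have h := lower_bound_of_stieltjes (Q := P) (f := fun x => y 0 x * z 0 x)
    (f' := fun x => y 1 x * z 0 x + y 0 x * z 1 x)
    (g := fun t => (y 3 t * z 0 t - y 2 t * z 1 t + y 1 t * z 2 t - y 0 t * z 3 t) / (μ - ν))
    (e := fun _ => 0) hδ hP.mono (fun x hx => hy.hasDerivWithinAt_mul hz hx)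
    ((hy.continuousOn_one.mul hz.continuousOn_zero).add
      (hy.continuousOn_zero.mul hz.continuousOn_one))
    (fun x hx => ((hy.hasDerivWithinAt_lagrange hz hx).div_const (μ - ν)).of_eq
      (fun t => by field_simp) (by field_simp; ring)) (fun _ _ => le_rfl) hc hε
  rw [hP.zero, hP.one, ← sub_div, sub_zero] at h
  have h0 : β * (y 3 0 * z 0 0 - y 2 0 * z 1 0 + y 1 0 * z 2 0 - y 0 0 * z 3 0) = 0 := by
    obtain ⟨p1, p2⟩ := hyL
    obtain ⟨q1, q2⟩ := hzL
    linear_combination (-z 0 0) * p2 + y 0 0 * q2 + (-β * z 1 0 + α * z 0 0) * p1 +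
      (β * y 1 0 - α * y 0 0) * q1
  have h1 : z 0 1 * gForm α β y - y 0 1 * gForm α β z =
      β * (y 3 1 * z 0 1 - y 2 1 * z 1 1 + y 1 1 * z 2 1 - y 0 1 * z 3 1) := by
    unfold bForm at hyB hzB
    unfold gForm
    linear_combination (α * z 0 1 + β * z 1 1) * hyB - (α * y 0 1 + β * y 1 1) * hzB
  refine (mul_le_mul_of_nonneg_left h hβ.le).trans_eq ?_
  rw [h1, ← mul_div_assoc]
  congr 1
  linear_combination -h0

/-- A continuous function on `[0,1]` with positive value at `0` stays away from zero nearby. -/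
lemma exists_le_near_zero {f : ℝ → ℝ} (hf : ContinuousOn f (Icc 0 1)) {c : ℝ} (h0 : c < f 0) :
    ∃ δ ∈ Ioc (0 : ℝ) 1, ∀ x ∈ Icc 0 δ, c ≤ f x := by
  have h := (hf 0 (left_mem_Icc.2 zero_le_one)).eventually (lt_mem_nhds h0)
  obtain ⟨δ, hδ, h⟩ := Metric.mem_nhdsWithin_iff.1 h
  refine ⟨min (δ / 2) 1, ⟨by positivity, min_le_right _ _⟩, fun x hx => le_of_lt (h ⟨?_, hx.1, ?_⟩)⟩
  · rw [Metric.mem_ball, Real.dist_eq, sub_zero, abs_of_nonneg hx.1]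
    linarith [hx.2, min_le_left (δ / 2) 1]
  · exact hx.2.trans (min_le_right _ _)

/-- There are no nontrivial solutions of the boundary value problem for negative parameters. -/
lemma eq_zero_of_neg (hP : IsWeight P) (hβ : 0 < β) (hμ : μ < 0)
    (hy : IsBeam P μ y) (hL : LeftBC α β y) (hB : bForm α β y = 0) (hG : gForm α β y = 0)
    {t : ℝ} (ht : t ∈ Icc (0 : ℝ) 1) : y 0 t = 0 := by
  have hkey : ∀ (c δ : ℝ), δ ∈ Icc (0 : ℝ) 1 → (∀ x ∈ Icc 0 δ, c ≤ y 0 x ^ 2) →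
      c * (-μ * P δ) ≤ -(y 3 1 * y 0 1 - y 2 1 * y 1 1) + (y 3 0 * y 0 0 - y 2 0 * y 1 0) := by
    intro c δ hδ hc
    have h := lower_bound_of_stieltjes (Q := fun x => -μ * P x) (f := fun x => y 0 x ^ 2)
      (f' := fun x => 2 * (y 0 x * y 1 x))
      (g := fun t => -(y 3 t * y 0 t - y 2 t * y 1 t)) (ε := 0)
      (e := fun x => y 2 x ^ 2) hδ
      (fun u hu v hv huv => mul_le_mul_of_nonneg_left (hP.mono hu hv huv) (by linarith))
      (fun x hx => (hy.hasDerivWithinAt_mul hy hx).of_eq (fun t => by ring) (by ring))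
      (continuousOn_const.mul (hy.continuousOn_zero.mul hy.continuousOn_one))
      (fun x hx => (((hy.2.2.1 x hx).mul (hy.2.1 x hx)).sub
        ((hy.2.2.2 x hx).mul (hy.1 x hx))).of_eq
          (fun t => by simp only [Pi.mul_apply, Pi.sub_apply]; ring) (by ring))
      (fun x _ => sq_nonneg _) hc (fun x _ => by simpa using sq_nonneg (y 0 x))
    rw [hP.zero] at h
    linarith
  have e0 : β * (y 3 0 * y 0 0 - y 2 0 * y 1 0) = -y 2 0 ^ 2 := by
    obtain ⟨p1, p2⟩ := hL
    linear_combination (-y 0 0) * p2 + y 2 0 * p1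
  have e1 : β * (y 3 1 * y 0 1 - y 2 1 * y 1 1) = y 2 1 ^ 2 := by
    unfold bForm at hB
    unfold gForm at hG
    linear_combination y 0 1 * hG - y 2 1 * hB
  have h00 : y 0 0 = 0 := by
    by_contra hne
    have hpos : 0 < y 0 0 ^ 2 := by positivity
    obtain ⟨δ, hδ, hc⟩ := exists_le_near_zero (hy.continuousOn_zero.pow 2) (half_lt_self hpos)
    have h := mul_le_mul_of_nonneg_left (hkey _ δ ⟨hδ.1.le, hδ.2⟩ hc) hβ.le
    have h1 : 0 < β * (y 0 0 ^ 2 / 2 * (-μ * P δ)) :=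
      mul_pos hβ (mul_pos (by positivity) (mul_pos (by linarith) (hP.pos δ hδ)))
    simp only [Pi.pow_apply] at h
    nlinarith [sq_nonneg (y 2 0), sq_nonneg (y 2 1)]
  have h20 : y 2 0 = 0 := by
    have h := mul_le_mul_of_nonneg_left (hkey 0 0 (left_mem_Icc.2 zero_le_one)
      (fun x _ => sq_nonneg _)) hβ.le
    have : y 2 0 ^ 2 = 0 := by nlinarith [sq_nonneg (y 2 0), sq_nonneg (y 2 1)]
    exact pow_eq_zero_iff two_ne_zero |>.1 this
  obtain ⟨p1, p2⟩ := hL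
  have h10 : y 1 0 = 0 := by
    have : β * y 1 0 = 0 := by rw [h00, h20] at p1; linarith
    exact (mul_eq_zero.1 this).resolve_left hβ.ne'
  have h30 : y 3 0 = 0 := by
    have : β * y 3 0 = 0 := by rw [h20] at p2; linarith
    exact (mul_eq_zero.1 this).resolve_left hβ.ne'
  refine hy.eq_zero (fun t ht => hP.abs_le_one ht) (fun i => ?_) ht 0
  fin_cases i
  exacts [h00, h10, h20, h30]

end IsBeam

/-- A normalised family of solutions that satisfy all boundary conditions except the last one. -/
structure IsShooting (P : ℝ → ℝ) (α β : ℝ) (Y : ℝ → Fin 4 → ℝ → ℝ) : Prop where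
  beam : ∀ μ, IsBeam P μ (Y μ)
  left : ∀ μ, LeftBC α β (Y μ)
  right : ∀ μ, 0 ≤ μ → bForm α β (Y μ) = 0
  one : ∀ μ, Y μ 0 0 = 1
  cont : ∀ μ, 0 ≤ μ → UnifContAt Y μ

namespace IsShooting

variable {P : ℝ → ℝ} {α β : ℝ} {Y : ℝ → Fin 4 → ℝ → ℝ}

lemma eventually_lagrange_pos (hP : IsWeight P) (hβ : 0 < β) (hY : IsShooting P α β Y) {μ₀ : ℝ}
    (hμ₀ : 0 ≤ μ₀) : ∀ᶠ μ in nhds μ₀, 0 ≤ μ → μ ≠ μ₀ →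
      0 < (Y μ₀ 0 1 * gForm α β (Y μ) - Y μ 0 1 * gForm α β (Y μ₀)) / (μ - μ₀) := by
  have hz := hY.beam μ₀
  obtain ⟨δ, hδ, hδz⟩ := IsBeam.exists_le_near_zero (c := 1 / 2) hz.continuousOn_zero
    (by rw [hY.one]; norm_num)
  obtain ⟨C, hC⟩ := isCompact_Icc.exists_bound_of_continuousOn hz.continuousOn_zero
  obtain ⟨M, hM, hMY⟩ := hY.cont μ₀ hμ₀
  have hMC : Tendsto (fun μ => M μ * C) (nhds μ₀) (nhds 0) := by simpa using hM.mul_const C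
  have hPδ := hP.pos δ hδ
  filter_upwards [hMC.eventually (gt_mem_nhds (show 0 < P δ / 4 by positivity))] with μ hμs hμ hne
  have hlow : ∀ x ∈ Icc (0 : ℝ) 1, Y μ₀ 0 x ^ 2 - M μ * C ≤ Y μ 0 x * Y μ₀ 0 x := by
    intro x hx
    have h1 : |(Y μ 0 x - Y μ₀ 0 x) * Y μ₀ 0 x| ≤ M μ * C := by
      rw [abs_mul]
      exact mul_le_mul (hMY μ x hx 0) (hC x hx) (abs_nonneg _)
        ((abs_nonneg _).trans (hMY μ x hx 0))
    linarith [(abs_le.1 h1).1]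
  have h := (hY.beam μ).lower_bound_lagrange hP hβ hz (hY.left μ) (hY.left μ₀) (hY.right μ hμ)
    (hY.right μ₀ hμ₀) hne ⟨hδ.1.le, hδ.2⟩ (c := 1 / 4 - M μ * C) (ε := M μ * C)
    (fun x hx => by
      have h1 := hlow x ⟨hx.1, hx.2.trans hδ.2⟩
      have h2 := hδz x hx
      nlinarith)
    (fun x hx => by linarith [hlow x hx, sq_nonneg (Y μ₀ 0 x)])
  refine lt_of_lt_of_le (mul_pos hβ ?_) h
  linarith

end IsShooting

/-! ### The shooting family -/

lemma LeftBC.add_smul {α β : ℝ} {y z : Fin 4 → ℝ → ℝ} (hy : LeftBC α β y) (hz : LeftBC α β z)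
    (q : ℝ) : LeftBC α β (y + q • z) := by
  obtain ⟨h1, h2⟩ := hy
  obtain ⟨k1, k2⟩ := hz
  constructor
  all_goals simp only [Pi.add_apply, Pi.smul_apply, smul_eq_mul]
  · linear_combination h1 + q * k1
  · linear_combination h2 + q * k2

lemma bForm_add_smul (α β : ℝ) (y z : Fin 4 → ℝ → ℝ) (q : ℝ) :
    bForm α β (y + q • z) = bForm α β y + q * bForm α β z := by
  simp only [bForm, Pi.add_apply, Pi.smul_apply, smul_eq_mul]
  ring

lemma UnifContAt.continuousAt_bForm {Y : ℝ → Fin 4 → ℝ → ℝ} {μ₀ : ℝ} (h : UnifContAt Y μ₀)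
    (α β : ℝ) : ContinuousAt (fun μ => bForm α β (Y μ)) μ₀ := by
  have h1 := fun i => h.continuousAt i (right_mem_Icc.2 zero_le_one)
  exact ((h1 2).add (continuousAt_const.mul (h1 0))).add (continuousAt_const.mul (h1 1))

lemma UnifContAt.continuousAt_gForm {Y : ℝ → Fin 4 → ℝ → ℝ} {μ₀ : ℝ} (h : UnifContAt Y μ₀)
    (α β : ℝ) : ContinuousAt (fun μ => gForm α β (Y μ)) μ₀ := by
  have h1 := fun i => h.continuousAt i (right_mem_Icc.2 zero_le_one)
  exact (continuousAt_const.mul (h1 3)).add (continuousAt_const.mul (h1 2))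

lemma IsBeam.continuousOn {P : ℝ → ℝ} (hPc : ContinuousOn P (Icc 0 1)) {μ : ℝ}
    {y : Fin 4 → ℝ → ℝ} (hy : IsBeam P μ y) (i : Fin 4) : ContinuousOn (y i) (Icc 0 1) := by
  have h3 : ContinuousOn (fun t => (y 3 t - μ * P t * y 0 t) + μ * P t * y 0 t) (Icc 0 1) :=
    ContinuousOn.add (fun x hx => (hy.2.2.2 x hx).continuousWithinAt)
      ((continuousOn_const.mul hPc).mul hy.continuousOn_zero)
  fin_cases i
  exacts [hy.continuousOn_zero, hy.continuousOn_one,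
    fun x hx => (hy.2.2.1 x hx).continuousWithinAt, by simpa using h3]

lemma UnifContAt.add_smul {P : ℝ → ℝ} (hPc : ContinuousOn P (Icc 0 1)) {U V : ℝ → Fin 4 → ℝ → ℝ}
    {q : ℝ → ℝ} {μ₀ : ℝ} (hU : UnifContAt U μ₀) (hV : UnifContAt V μ₀) (hq : ContinuousAt q μ₀)
    (hVb : IsBeam P μ₀ (V μ₀)) : UnifContAt (fun μ => U μ + q μ • V μ) μ₀ := by
  obtain ⟨M, hM, hUM⟩ := hU
  obtain ⟨N, hN, hVN⟩ := hV
  choose C hC using fun i => isCompact_Icc.exists_bound_of_continuousOn (hVb.continuousOn hPc i)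
  have hCK : ∀ i, C i ≤ ∑ i, |C i| := fun i => (le_abs_self _).trans
    (Finset.single_le_sum (f := fun i => |C i|) (fun _ _ => abs_nonneg _) (Finset.mem_univ i))
  refine ⟨fun μ => M μ + |q μ| * N μ + |q μ - q μ₀| * ∑ i, |C i|, ?_, fun μ x hx i => ?_⟩
  · have h1 : Tendsto (fun μ => |q μ - q μ₀|) (nhds μ₀) (nhds |q μ₀ - q μ₀|) :=
      (hq.tendsto.sub_const _).abs
    simpa using (hM.add (hq.tendsto.abs.mul hN)).add (h1.mul_const (∑ i, |C i|))
  · have h1 := hUM μ x hx i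
    have h2 : |q μ * (V μ i x - V μ₀ i x)| ≤ |q μ| * N μ := by
      rw [abs_mul]
      exact mul_le_mul_of_nonneg_left (hVN μ x hx i) (abs_nonneg _)
    have h3 : |(q μ - q μ₀) * V μ₀ i x| ≤ |q μ - q μ₀| * ∑ i, |C i| := by
      rw [abs_mul]
      exact mul_le_mul_of_nonneg_left ((hC i x hx).trans (hCK i)) (abs_nonneg _)
    simp only [Pi.add_apply, Pi.smul_apply, smul_eq_mul]
    calc |U μ i x + q μ * V μ i x - (U μ₀ i x + q μ₀ * V μ₀ i x)|
        = |(U μ i x - U μ₀ i x) + q μ * (V μ i x - V μ₀ i x) + (q μ - q μ₀) * V μ₀ i x| := by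
          congr 1
          ring
      _ ≤ _ := (abs_add_three _ _ _).trans (by linarith)

namespace IsBeam

variable {P : ℝ → ℝ} {α β μ : ℝ} {y : Fin 4 → ℝ → ℝ}

lemma bForm_pos (hP : IsWeight P) (hα : 0 ≤ α) (hβ : 0 < β) (hμ : 0 ≤ μ) (hy : IsBeam P μ y)
    (h0 : 0 ≤ y 0 0) (h1 : 0 < y 1 0) (h2 : 0 ≤ y 2 0) (h3 : 0 ≤ y 3 0) : 0 < bForm α β y := by
  have hnn : ∀ i, 0 ≤ y i 0 := by
    intro i
    fin_cases i
    exacts [h0, h1.le, h2, h3]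
  obtain ⟨a0, a1⟩ := hy.pos_right hP.mono hP.sub_le_one hμ le_rfl hnn (by linarith)
    (x := 1) ⟨zero_lt_one, le_rfl⟩
  have a2 := hy.nonneg_right hP.mono hP.sub_le_one hμ le_rfl hnn (right_mem_Icc.2 zero_le_one) 2
  unfold bForm
  positivity

lemma le_zero_of_left (hP : IsWeight P) (hα : 0 ≤ α) (hβ : 0 < β) (hμ : 0 ≤ μ)
    (hy : IsBeam P μ y) (hL : LeftBC α β y) (hB : bForm α β y = 0) (h0 : y 0 0 = 0) :
    y 1 0 ≤ 0 := by
  by_contra! h1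
  have h2 : y 2 0 = β * y 1 0 := by
    have := hL.1
    rw [h0] at this
    linarith
  have h2' : 0 < y 2 0 := h2 ▸ mul_pos hβ h1
  have h3 : 0 ≤ y 3 0 := by
    have := hL.2
    have := mul_nonneg hα h2'.le
    exact nonneg_of_mul_nonneg_right (by linarith) hβ
  exact (hy.bForm_pos hP hα hβ hμ h0.ge h1 h2'.le h3).ne' hB

lemma eq_zero_of_left (hP : IsWeight P) (hα : 0 ≤ α) (hβ : 0 < β) (hμ : 0 ≤ μ)
    (hy : IsBeam P μ y) (hL : LeftBC α β y) (hB : bForm α β y = 0) (h0 : y 0 0 = 0) {t : ℝ}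
    (ht : t ∈ Icc (0 : ℝ) 1) (i : Fin 4) : y i t = 0 := by
  have h1 : y 1 0 = 0 := by
    refine le_antisymm (le_zero_of_left hP hα hβ hμ hy hL hB h0) ?_
    simpa using le_zero_of_left hP hα hβ hμ hy.neg hL.neg (by rw [bForm_neg, hB, neg_zero])
      (by simp [h0])
  obtain ⟨p1, p2⟩ := hL
  have h2 : y 2 0 = 0 := by simpa [h0, h1] using p1
  have h3 : y 3 0 = 0 := by simpa [h2, hβ.ne'] using p2
  refine hy.eq_zero (fun t ht => hP.abs_le_one ht) (fun i => ?_) ht i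
  fin_cases i
  exacts [h0, h1, h2, h3]

end IsBeam

lemma exists_isShooting {P : ℝ → ℝ} (hP : IsWeight P) {α β : ℝ} (hα : 0 ≤ α) (hβ : 0 < β) :
    ∃ Y, IsShooting P α β Y := by
  obtain ⟨U, hU, hU0, hUc⟩ := exists_beam_family hP.cont (fun t ht => hP.abs_le_one ht) hP.zero
    ![1, α / β, 0, 0]
  obtain ⟨V, hV, hV0, hVc⟩ := exists_beam_family hP.cont (fun t ht => hP.abs_le_one ht) hP.zero
    ![0, 1 / β, 1, α / β]
  have hUL : ∀ μ, LeftBC α β (U μ) := fun μ => by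
    constructor
    all_goals simp [hU0]
    field_simp
    ring
  have hVL : ∀ μ, LeftBC α β (V μ) := fun μ => by
    constructor
    all_goals
      simp [hV0]
      field_simp
      ring
  have hVB : ∀ μ, 0 ≤ μ → 0 < bForm α β (V μ) := fun μ hμ =>
    (hV μ).bForm_pos hP hα hβ hμ (by simp [hV0]) (by simp [hV0, hβ]) (by simp [hV0])
      (by simp only [hV0]; simp; positivity)
  set q : ℝ → ℝ := fun μ => -bForm α β (U μ) / bForm α β (V μ) with hq
  refine ⟨fun μ => U μ + q μ • V μ, fun μ => (hU μ).add ((hV μ).const_smul _),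
    fun μ => (hUL μ).add_smul (hVL μ) _, fun μ hμ => ?_, fun μ => ?_, fun μ hμ => ?_⟩
  · rw [bForm_add_smul, hq, div_mul_cancel₀ _ (hVB μ hμ).ne', add_neg_cancel]
  · simp [hU0, hV0]
  · exact (hUc μ).add_smul hP.cont (hVc μ)
      (((hUc μ).continuousAt_bForm α β).neg.div ((hVc μ).continuousAt_bForm α β) (hVB μ hμ).ne')
      (hV μ)

lemma antitoneOn_Icc_of_hasDerivWithinAt_nonpos {f f' : ℝ → ℝ} {a b : ℝ}
    (hf : ∀ x ∈ Icc a b, HasDerivWithinAt f (f' x) (Icc a b) x)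
    (hf' : ∀ x ∈ Icc a b, f' x ≤ 0) : AntitoneOn f (Icc a b) :=
  antitoneOn_of_hasDerivWithinAt_nonpos (convex_Icc a b)
    (fun x hx => (hf x hx).continuousWithinAt)
    (fun x hx => (hf x (interior_subset hx)).mono interior_subset)
    (fun x hx => hf' x (interior_subset hx))

namespace IsShooting

variable {P : ℝ → ℝ} {α β : ℝ} {Y : ℝ → Fin 4 → ℝ → ℝ}

/-- For the parameter `0` the shooting solution has no zeros. -/
lemma pos_zero (hP : IsWeight P) (hα : 0 ≤ α) (hβ : 0 < β) (hY : IsShooting P α β Y) :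
    (∀ t ∈ Icc (0 : ℝ) 1, 0 < Y 0 0 t) ∧ gForm α β (Y 0) ≤ 0 := by
  have hy := hY.beam 0
  obtain ⟨l1, l2⟩ := hY.left 0
  have hB := hY.right 0 le_rfl
  rw [hY.one] at l1
  have h0m : (0 : ℝ) ∈ Icc (0 : ℝ) 1 := left_mem_Icc.2 zero_le_one
  have h1m : (1 : ℝ) ∈ Icc (0 : ℝ) 1 := right_mem_Icc.2 zero_le_one
  have h20 : Y 0 2 0 ≤ 0 := by
    by_contra! h
    have h1 : 0 < Y 0 1 0 := pos_of_mul_pos_right (by linarith : 0 < β * Y 0 1 0) hβ.le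
    have h3 : 0 ≤ Y 0 3 0 :=
      nonneg_of_mul_nonneg_right (by linarith [mul_nonneg hα h.le] : 0 ≤ β * Y 0 3 0) hβ
    exact (hy.bForm_pos hP hα hβ le_rfl (by simp [hY.one]) h1 h.le h3).ne' hB
  have h30 : Y 0 3 0 ≤ 0 := by
    by_contra! h
    nlinarith [mul_pos hβ h, mul_nonneg hα (neg_nonneg.2 h20)]
  have h3 : ∀ t ∈ Icc (0 : ℝ) 1, Y 0 3 t ≤ 0 := by
    have h := antitoneOn_Icc_of_hasDerivWithinAt_nonpos (f := Y 0 3) (f' := fun _ => 0)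
      (fun x hx => (hy.2.2.2 x hx).of_eq (fun t => by simp) (by simp)) (fun _ _ => le_rfl)
    exact fun t ht => (h h0m ht ht.1).trans h30
  have h2 : ∀ t ∈ Icc (0 : ℝ) 1, Y 0 2 t ≤ 0 := fun t ht =>
    (antitoneOn_Icc_of_hasDerivWithinAt_nonpos hy.2.2.1 h3 h0m ht ht.1).trans h20
  have h1 := antitoneOn_Icc_of_hasDerivWithinAt_nonpos hy.2.1 h2
  refine ⟨fun t ht => ?_, ?_⟩
  · by_contra! hneg
    have hl : Icc 0 t ⊆ Icc (0 : ℝ) 1 := Icc_subset_Icc le_rfl ht.2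
    have hr : Icc t 1 ⊆ Icc (0 : ℝ) 1 := Icc_subset_Icc ht.1 le_rfl
    have hlt : Y 0 1 t < 0 := by
      by_contra! hge
      have := monotoneOn_Icc_of_hasDerivWithinAt_nonneg (fun x hx => (hy.1 x (hl hx)).mono hl)
        (fun x hx => hge.trans (h1 (hl hx) ht hx.2)) (left_mem_Icc.2 ht.1) (right_mem_Icc.2 ht.1)
        ht.1
      rw [hY.one] at this
      linarith
    have h01 := antitoneOn_Icc_of_hasDerivWithinAt_nonpos (fun x hx => (hy.1 x (hr hx)).mono hr)
      (fun x hx => (h1 ht (hr hx) hx.1).trans hlt.le) (left_mem_Icc.2 ht.2) (right_mem_Icc.2 ht.2)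
      ht.2
    have h11 := h1 ht h1m ht.2
    unfold bForm at hB
    nlinarith [h2 1 h1m]
  · unfold gForm
    nlinarith [h2 1 h1m, h3 1 h1m]

/-- Solutions that satisfy the first three boundary conditions are multiples of the shooting
solution. -/
lemma eq_mul (hP : IsWeight P) (hα : 0 ≤ α) (hβ : 0 < β) (hY : IsShooting P α β Y) {μ : ℝ}
    (hμ : 0 ≤ μ) {y : Fin 4 → ℝ → ℝ} (hy : IsBeam P μ y) (hL : LeftBC α β y)
    (hB : bForm α β y = 0) {t : ℝ} (ht : t ∈ Icc (0 : ℝ) 1) (i : Fin 4) :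
    y i t = y 0 0 * Y μ i t := by
  have h := (hy.add ((hY.beam μ).const_smul (-y 0 0))).eq_zero_of_left hP hα hβ hμ
    (hL.add_smul (hY.left μ) _) (by rw [bForm_add_smul, hB, hY.right μ hμ]; ring)
    (by simp [hY.one]) ht i
  simp only [Pi.add_apply, Pi.smul_apply, smul_eq_mul] at h
  linarith

end IsShooting

/-! ### Eigenfunctions and the shooting family -/

/-- An eigenfunction together with its derivatives. -/
noncomputable def jet (y : ℝ → ℝ) : Fin 4 → ℝ → ℝ := ![y, Y1 y, Y2 y, Y3 y]

lemma Eigenfunction.isBeam {P : ℝ → ℝ} {α β μ : ℝ} {y : ℝ → ℝ} (h : Eigenfunction P α β μ y) :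
    IsBeam P μ (jet y) := by
  obtain ⟨-, ⟨hc, hd⟩, -⟩ := h
  have hu : UniqueDiffOn ℝ (Icc (0 : ℝ) 1) := uniqueDiffOn_Icc_zero_one
  have hstep : ∀ m : ℕ, m < 3 → ∀ x ∈ Icc (0 : ℝ) 1,
      HasDerivWithinAt (iteratedDerivWithin m y (Icc 0 1))
        (iteratedDerivWithin (m + 1) y (Icc 0 1) x) (Icc 0 1) x := by
    intro m hm x hx
    rw [iteratedDerivWithin_succ]
    exact (hc.differentiableOn_iteratedDerivWithin (by exact_mod_cast hm) hu x hx).hasDerivWithinAt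
  have e1 : iteratedDerivWithin 1 y (Icc 0 1) = Y1 y := iteratedDerivWithin_one
  have h0 := hstep 0 (by norm_num)
  have h1 := hstep 1 (by norm_num)
  rw [zero_add, e1, iteratedDerivWithin_zero] at h0
  rw [e1] at h1
  exact ⟨h0, h1, hstep 2 (by norm_num), hd⟩

lemma Eigenfunction.leftBC {P : ℝ → ℝ} {α β μ : ℝ} {y : ℝ → ℝ} (h : Eigenfunction P α β μ y) :
    LeftBC α β (jet y) :=
  ⟨h.2.2.1, h.2.2.2.1⟩

lemma Eigenfunction.bForm_eq_zero {P : ℝ → ℝ} {α β μ : ℝ} {y : ℝ → ℝ}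
    (h : Eigenfunction P α β μ y) : bForm α β (jet y) = 0 :=
  h.2.2.2.2.1

lemma Eigenfunction.gForm_eq_zero {P : ℝ → ℝ} {α β μ : ℝ} {y : ℝ → ℝ}
    (h : Eigenfunction P α β μ y) : gForm α β (jet y) = 0 := by
  have h1 : -β * jet y 3 1 - α * jet y 2 1 = 0 := h.2.2.2.2.2
  unfold gForm
  linarith

lemma Eigenfunction.nonneg {P : ℝ → ℝ} (hP : IsWeight P) {α β μ : ℝ} (hβ : 0 < β) {y : ℝ → ℝ}
    (h : Eigenfunction P α β μ y) : 0 ≤ μ := by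
  by_contra! hμ
  obtain ⟨x, hx, hne⟩ := h.1
  exact hne (h.isBeam.eq_zero_of_neg hP hβ hμ h.leftBC h.bForm_eq_zero h.gForm_eq_zero hx)

lemma IsBeam.iteratedDerivWithin_eq {P : ℝ → ℝ} {μ : ℝ} {y : Fin 4 → ℝ → ℝ} (hy : IsBeam P μ y)
    (i : Fin 4) : EqOn (iteratedDerivWithin i (y 0) (Icc 0 1)) (y i) (Icc 0 1) := by
  have hu : UniqueDiffOn ℝ (Icc (0 : ℝ) 1) := uniqueDiffOn_Icc_zero_one
  have hstep : ∀ (m : ℕ) (f f' : ℝ → ℝ), EqOn (iteratedDerivWithin m (y 0) (Icc 0 1)) f (Icc 0 1) →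
      (∀ x ∈ Icc (0 : ℝ) 1, HasDerivWithinAt f (f' x) (Icc 0 1) x) →
      EqOn (iteratedDerivWithin (m + 1) (y 0) (Icc 0 1)) f' (Icc 0 1) := by
    intro m f f' he hf x hx
    rw [iteratedDerivWithin_succ, derivWithin_congr he (he hx)]
    exact (hf x hx).derivWithin (hu x hx)
  have h0 : EqOn (iteratedDerivWithin 0 (y 0) (Icc 0 1)) (y 0) (Icc 0 1) := fun x _ => by simp
  have h1 := hstep 0 _ _ h0 hy.1
  have h2 := hstep 1 _ _ h1 hy.2.1
  have h3 := hstep 2 _ _ h2 hy.2.2.1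
  fin_cases i
  exacts [h0, h1, h2, h3]

lemma IsBeam.eigenfunction {P : ℝ → ℝ} (hP : IsWeight P) {α β μ : ℝ} {y : Fin 4 → ℝ → ℝ}
    (hy : IsBeam P μ y) (hL : LeftBC α β y) (hB : bForm α β y = 0) (hG : gForm α β y = 0)
    (h0 : y 0 0 ≠ 0) : Eigenfunction P α β μ (y 0) := by
  have h0m : (0 : ℝ) ∈ Icc (0 : ℝ) 1 := left_mem_Icc.2 zero_le_one
  have h1m : (1 : ℝ) ∈ Icc (0 : ℝ) 1 := right_mem_Icc.2 zero_le_one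
  have e1 : EqOn (Y1 (y 0)) (y 1) (Icc 0 1) := fun x hx => by
    rw [← hy.iteratedDerivWithin_eq 1 hx]
    exact congrFun iteratedDerivWithin_one.symm x
  have e2 : EqOn (Y2 (y 0)) (y 2) (Icc 0 1) := hy.iteratedDerivWithin_eq 2
  have e3 : EqOn (Y3 (y 0)) (y 3) (Icc 0 1) := hy.iteratedDerivWithin_eq 3
  refine ⟨⟨0, h0m, h0⟩, ⟨?_, fun x hx => ?_⟩, ?_⟩
  · refine contDiffOn_of_continuousOn_differentiableOn_deriv (fun m hm => ?_) (fun m hm => ?_)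
    · have hm' : m ≤ 3 := by exact_mod_cast hm
      exact (hy.continuousOn hP.cont ⟨m, by omega⟩).congr (hy.iteratedDerivWithin_eq ⟨m, by omega⟩)
    · have hm' : m < 3 := by exact_mod_cast hm
      refine DifferentiableOn.congr (f := y ⟨m, by omega⟩) ?_
        (hy.iteratedDerivWithin_eq ⟨m, by omega⟩)
      interval_cases m
      exacts [fun x hx => (hy.1 x hx).differentiableWithinAt,
        fun x hx => (hy.2.1 x hx).differentiableWithinAt,
        fun x hx => (hy.2.2.1 x hx).differentiableWithinAt]
  · rw [e1 hx]
    exact (hy.2.2.2 x hx).congr (fun t ht => by rw [e3 ht]) (by rw [e3 hx])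
  · unfold gForm at hG
    refine ⟨?_, ?_, ?_, ?_⟩
    · rw [e1 h0m, e2 h0m]
      exact hL.1
    · rw [e2 h0m, e3 h0m]
      exact hL.2
    · rw [e1 h1m, e2 h1m]
      exact hB
    · rw [e2 h1m, e3 h1m]
      linarith

namespace IsShooting

variable {P : ℝ → ℝ} {α β : ℝ} {Y : ℝ → Fin 4 → ℝ → ℝ}

lemma exists_eq_mul (hP : IsWeight P) (hα : 0 ≤ α) (hβ : 0 < β) (hY : IsShooting P α β Y) {μ : ℝ}
    {y : ℝ → ℝ} (h : Eigenfunction P α β μ y) :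
    y 0 ≠ 0 ∧ (∀ t ∈ Icc (0 : ℝ) 1, y t = y 0 * Y μ 0 t) ∧ gForm α β (Y μ) = 0 := by
  have hμ := h.nonneg hP hβ
  have hmul : ∀ t ∈ Icc (0 : ℝ) 1, ∀ i, jet y i t = y 0 * Y μ i t := fun t ht i =>
    hY.eq_mul hP hα hβ hμ h.isBeam h.leftBC h.bForm_eq_zero ht i
  have h0 : y 0 ≠ 0 := by
    intro h0
    obtain ⟨x, hx, hne⟩ := h.1
    exact hne ((hmul x hx 0).trans (by rw [h0, zero_mul]))
  refine ⟨h0, fun t ht => hmul t ht 0, ?_⟩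
  have hG := h.gForm_eq_zero
  have h1m : (1 : ℝ) ∈ Icc (0 : ℝ) 1 := right_mem_Icc.2 zero_le_one
  rw [gForm, hmul 1 h1m, hmul 1 h1m] at hG
  have : y 0 * gForm α β (Y μ) = 0 := by
    unfold gForm
    linarith
  exact (mul_eq_zero.1 this).resolve_left h0

lemma isEigenvalue_iff (hP : IsWeight P) (hα : 0 ≤ α) (hβ : 0 < β) (hY : IsShooting P α β Y)
    {μ : ℝ} : IsEigenvalue P α β μ ↔ 0 ≤ μ ∧ gForm α β (Y μ) = 0 := by
  constructor
  · rintro ⟨y, hy⟩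
    exact ⟨hy.nonneg hP hβ, (hY.exists_eq_mul hP hα hβ hy).2.2⟩
  · rintro ⟨hμ, hG⟩
    exact ⟨Y μ 0, (hY.beam μ).eigenfunction hP (hY.left μ) (hY.right μ hμ) hG (by simp [hY.one])⟩

end IsShooting

/-! ### Stability of the number of zeros under `C¹`-small perturbations -/

/-- The zeros of `g` in the open interval `(s,t)`. -/
def zeroSet (g : ℝ → ℝ) (s t : ℝ) : Set ℝ := {x ∈ Ioo s t | g x = 0}

/-- On `[s,t]` the function `g` is strictly monotone or has no zeros. -/
def IsTame (g : ℝ → ℝ) (s t : ℝ) : Prop :=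
  StrictMonoOn g (Icc s t) ∨ StrictAntiOn g (Icc s t) ∨ ∀ x ∈ Icc s t, g x ≠ 0

lemma zeroSet_neg (g : ℝ → ℝ) (s t : ℝ) : zeroSet (-g) s t = zeroSet g s t := by
  simp [zeroSet]

lemma encard_zeroSet_of_strictMonoOn {g : ℝ → ℝ} {s t : ℝ} (hst : s < t)
    (hc : ContinuousOn g (Icc s t)) (hg : StrictMonoOn g (Icc s t)) :
    (zeroSet g s t).encard = if g s * g t < 0 then 1 else 0 := by
  have hsm : s ∈ Icc s t := left_mem_Icc.2 hst.le
  have htm : t ∈ Icc s t := right_mem_Icc.2 hst.le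
  have hlt := hg hsm htm hst
  by_cases h : g s < 0 ∧ 0 < g t
  · obtain ⟨x₀, hx₀, h0⟩ := intermediate_value_Ioo hst.le hc h
    rw [if_pos (mul_neg_of_neg_of_pos h.1 h.2), encard_eq_one]
    refine ⟨x₀, Subset.antisymm (fun x hx => ?_) (singleton_subset_iff.2 ⟨hx₀, h0⟩)⟩
    exact hg.injOn (Ioo_subset_Icc_self hx.1) (Ioo_subset_Icc_self hx₀) (hx.2.trans h0.symm)
  · rw [if_neg, encard_eq_zero, eq_empty_iff_forall_notMem]
    · rintro x ⟨hx, h0⟩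
      exact h ⟨h0 ▸ hg hsm (Ioo_subset_Icc_self hx) hx.1, h0 ▸ hg (Ioo_subset_Icc_self hx) htm hx.2⟩
    · intro hneg
      rcases mul_neg_iff.1 hneg with h' | h'
      · linarith
      · exact h h'

lemma IsTame.encard_zeroSet {g : ℝ → ℝ} {s t : ℝ} (hst : s < t) (hc : ContinuousOn g (Icc s t))
    (hg : IsTame g s t) : (zeroSet g s t).encard = if g s * g t < 0 then 1 else 0 := by
  rcases hg with hg | hg | hg
  · exact encard_zeroSet_of_strictMonoOn hst hc hg
  · simpa [zeroSet_neg] using encard_zeroSet_of_strictMonoOn hst hc.neg hg.neg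
  · rw [if_neg, encard_eq_zero, eq_empty_iff_forall_notMem]
    · exact fun x hx => hg x (Ioo_subset_Icc_self hx.1) hx.2
    · intro hneg
      rcases mul_neg_iff.1 hneg with h | h
      · obtain ⟨x, hx, h0⟩ := intermediate_value_Icc' hst.le hc ⟨h.2.le, h.1.le⟩
        exact hg x hx h0
      · obtain ⟨x, hx, h0⟩ := intermediate_value_Icc hst.le hc ⟨h.1.le, h.2.le⟩
        exact hg x hx h0

lemma encard_zeroSet_add {g : ℝ → ℝ} {r s t : ℝ} (hrs : r < s) (hst : s < t) (hg : g s ≠ 0) :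
    (zeroSet g r t).encard = (zeroSet g r s).encard + (zeroSet g s t).encard := by
  rw [← encard_union_eq]
  · congr 1
    ext x
    constructor
    · rintro ⟨hx, h0⟩
      rcases lt_trichotomy x s with h | rfl | h
      · exact Or.inl ⟨⟨hx.1, h⟩, h0⟩
      · exact (hg h0).elim
      · exact Or.inr ⟨⟨h, hx.2⟩, h0⟩
    · rintro (⟨hx, h0⟩ | ⟨hx, h0⟩)
      · exact ⟨⟨hx.1, hx.2.trans hst⟩, h0⟩
      · exact ⟨⟨hrs.trans hx.1, hx.2⟩, h0⟩
  · exact Set.disjoint_left.2 fun x hx hx' => lt_asymm hx.1.2 hx'.1.1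

lemma IsTame.of_pos {g g' : ℝ → ℝ} {s t : ℝ}
    (hg : ∀ x ∈ Icc s t, HasDerivWithinAt g (g' x) (Icc s t) x)
    (h : (∀ x ∈ Icc s t, 0 < g' x) ∨ (∀ x ∈ Icc s t, g' x < 0) ∨ ∀ x ∈ Icc s t, g x ≠ 0) :
    IsTame g s t := by
  have hc : ContinuousOn g (Icc s t) := fun x hx => (hg x hx).continuousWithinAt
  have hd : ∀ x ∈ interior (Icc s t), HasDerivWithinAt g (g' x) (interior (Icc s t)) x :=
    fun x hx => (hg x (interior_subset hx)).mono interior_subset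
  rcases h with h | h | h
  · exact Or.inl (strictMonoOn_of_hasDerivWithinAt_pos (convex_Icc s t) hc hd
      fun x hx => h x (interior_subset hx))
  · exact Or.inr (Or.inl (strictAntiOn_of_hasDerivWithinAt_neg (convex_Icc s t) hc hd
      fun x hx => h x (interior_subset hx)))
  · exact Or.inr (Or.inr h)

/-- A `C¹` function on `[0,1]`, nonzero at `0` and without multiple zeros. -/
structure IsSimple (f f' : ℝ → ℝ) : Prop where
  deriv : ∀ x ∈ Icc (0 : ℝ) 1, HasDerivWithinAt f (f' x) (Icc 0 1) x
  cont : ContinuousOn f' (Icc 0 1)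
  simple : ∀ x ∈ Icc (0 : ℝ) 1, f x = 0 → f' x ≠ 0
  zero : f 0 ≠ 0

/-- The family `h` converges to `f` in `C¹[0,1]` along the filter `l`. -/
structure TendstoC1 {ι : Type*} (l : Filter ι) (h h' : ι → ℝ → ℝ) (f f' : ℝ → ℝ) : Prop where
  deriv : ∀ i, ∀ x ∈ Icc (0 : ℝ) 1, HasDerivWithinAt (h i) (h' i x) (Icc 0 1) x
  close : ∀ ε > 0, ∀ᶠ i in l, ∀ x ∈ Icc (0 : ℝ) 1, |h i x - f x| < ε ∧ |h' i x - f' x| < ε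

lemma IsSimple.continuousOn {f f' : ℝ → ℝ} (hf : IsSimple f f') : ContinuousOn f (Icc 0 1) :=
  fun x hx => (hf.deriv x hx).continuousWithinAt

/-- On sufficiently short intervals `f` or `f'` is uniformly away from zero. -/
lemma IsSimple.exists_short {f f' : ℝ → ℝ} (hf : IsSimple f f') :
    ∃ r > 0, r < 1 ∧ ∃ m > 0, ∀ s t, 0 ≤ s → s ≤ t → t ≤ 1 → t - s ≤ r →
      (∀ x ∈ Icc s t, m ≤ f' x) ∨ (∀ x ∈ Icc s t, f' x ≤ -m) ∨ (∀ x ∈ Icc s t, m ≤ |f x|) := by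
  obtain ⟨x₀, hx₀, hmin⟩ := isCompact_Icc.exists_isMinOn (nonempty_Icc.2 zero_le_one)
    (hf.continuousOn.abs.add hf.cont.abs)
  have hpos : 0 < |f x₀| + |f' x₀| := by
    rcases eq_or_ne (f x₀) 0 with h | h
    · exact add_pos_of_nonneg_of_pos (abs_nonneg _) (abs_pos.2 (hf.simple x₀ hx₀ h))
    · exact add_pos_of_pos_of_nonneg (abs_pos.2 h) (abs_nonneg _)
  set m := (|f x₀| + |f' x₀|) / 4 with hm
  have hm0 : 0 < m := by positivity
  obtain ⟨r₁, hr₁, h₁⟩ := Metric.uniformContinuousOn_iff.1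
    (isCompact_Icc.uniformContinuousOn_of_continuous hf.continuousOn) m hm0
  obtain ⟨r₂, hr₂, h₂⟩ := Metric.uniformContinuousOn_iff.1
    (isCompact_Icc.uniformContinuousOn_of_continuous hf.cont) m hm0
  simp only [Real.dist_eq] at h₁ h₂
  have hr : 0 < min (min r₁ r₂) 1 := lt_min (lt_min hr₁ hr₂) one_pos
  refine ⟨min (min r₁ r₂) 1 / 2, half_pos hr, ?_, m, hm0, fun s t hs hst ht hr' => ?_⟩
  · linarith [min_le_right (min r₁ r₂) 1]
  have hlt : ∀ x ∈ Icc s t, x ∈ Icc (0 : ℝ) 1 ∧ |f x - f s| < m ∧ |f' x - f' s| < m := by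
    intro x hx
    have hx' : x ∈ Icc (0 : ℝ) 1 := ⟨hs.trans hx.1, hx.2.trans ht⟩
    have hs' : s ∈ Icc (0 : ℝ) 1 := ⟨hs, hst.trans ht⟩
    have hd : |x - s| < min r₁ r₂ := by
      rw [abs_of_nonneg (sub_nonneg.2 hx.1)]
      linarith [min_le_left (min r₁ r₂) 1, hx.2]
    exact ⟨hx', h₁ x hx' s hs' (hd.trans_le (min_le_left _ _)),
      h₂ x hx' s hs' (hd.trans_le (min_le_right _ _))⟩
  have hs0 : |f x₀| + |f' x₀| ≤ |f s| + |f' s| := hmin ⟨hs, hst.trans ht⟩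
  rcases le_or_gt (2 * m) |f s| with h | h
  · refine Or.inr (Or.inr fun x hx => ?_)
    have := abs_sub_abs_le_abs_sub (f s) (f x)
    rw [abs_sub_comm] at this
    linarith [(hlt x hx).2.1]
  · have h' : 2 * m ≤ |f' s| := by linarith
    rcases le_abs'.1 h' with h' | h'
    · exact Or.inr (Or.inl fun x hx => by linarith [(abs_lt.1 (hlt x hx).2.2).2])
    · exact Or.inl fun x hx => by linarith [(abs_lt.1 (hlt x hx).2.2).1]

section Stability

variable {ι : Type*} {l : Filter ι} {h h' : ι → ℝ → ℝ} {f f' : ℝ → ℝ}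

lemma TendstoC1.eventually_isTame (hh : TendstoC1 l h h' f f') {m s t : ℝ} (hm : 0 < m)
    (hs : 0 ≤ s) (ht : t ≤ 1) (H : (∀ x ∈ Icc s t, m ≤ f' x) ∨ (∀ x ∈ Icc s t, f' x ≤ -m) ∨
      (∀ x ∈ Icc s t, m ≤ |f x|)) : ∀ᶠ i in l, IsTame (h i) s t := by
  have hsub : Icc s t ⊆ Icc (0 : ℝ) 1 := Icc_subset_Icc hs ht
  filter_upwards [hh.close m hm] with i hi
  refine IsTame.of_pos (fun x hx => (hh.deriv i x (hsub hx)).mono hsub) ?_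
  refine H.imp (fun H x hx => ?_) (Or.imp (fun H x hx => ?_) (fun H x hx h0 => ?_))
  · linarith [H x hx, (abs_lt.1 (hi x (hsub hx)).2).1]
  · linarith [H x hx, (abs_lt.1 (hi x (hsub hx)).2).2]
  · have := (hi x (hsub hx)).1
    rw [h0, zero_sub, abs_neg] at this
    linarith [H x hx]

lemma TendstoC1.refl (hf : IsSimple f f') : TendstoC1 l (fun _ : ι => f) (fun _ => f') f f' :=
  ⟨fun _ => hf.deriv, fun ε hε => Eventually.of_forall fun _ x _ => by simpa using hε⟩

lemma TendstoC1.tendsto (hh : TendstoC1 l h h' f f') {x : ℝ} (hx : x ∈ Icc (0 : ℝ) 1) :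
    Tendsto (fun i => h i x) l (nhds (f x)) :=
  Metric.tendsto_nhds.2 fun ε hε => (hh.close ε hε).mono fun _ hi => (hi x hx).1

lemma TendstoC1.eventually_encard_eq (hh : TendstoC1 l h h' f f') {m s t : ℝ} (hm : 0 < m)
    (hs : 0 ≤ s) (hst : s < t) (ht : t ≤ 1)
    (H : (∀ x ∈ Icc s t, m ≤ f' x) ∨ (∀ x ∈ Icc s t, f' x ≤ -m) ∨ (∀ x ∈ Icc s t, m ≤ |f x|)) :
    ∀ᶠ i in l, (zeroSet (h i) s t).encard = if h i s * h i t < 0 then 1 else 0 := by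
  have hsub : Icc s t ⊆ Icc (0 : ℝ) 1 := Icc_subset_Icc hs ht
  filter_upwards [hh.eventually_isTame hm hs ht H] with i hi
  exact hi.encard_zeroSet hst fun x hx => ((hh.deriv i x (hsub hx)).mono hsub).continuousWithinAt

lemma Filter.Tendsto.eventually_neg_iff {u : ι → ℝ} {a : ℝ} (hu : Tendsto u l (nhds a))
    (ha : a ≠ 0) : ∀ᶠ i in l, (u i < 0 ↔ a < 0) := by
  rcases lt_or_gt_of_ne ha with ha | ha
  · filter_upwards [hu.eventually (gt_mem_nhds ha)] with i hi
    exact iff_of_true hi ha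
  · filter_upwards [hu.eventually (lt_mem_nhds ha)] with i hi
    exact iff_of_false hi.not_gt ha.not_gt

lemma IsSimple.encard_eq (hf : IsSimple f f') {m s t : ℝ} (hm : 0 < m)
    (hs : 0 ≤ s) (hst : s < t) (ht : t ≤ 1)
    (H : (∀ x ∈ Icc s t, m ≤ f' x) ∨ (∀ x ∈ Icc s t, f' x ≤ -m) ∨ (∀ x ∈ Icc s t, m ≤ |f x|)) :
    (zeroSet f s t).encard = if f s * f t < 0 then 1 else 0 :=
  ((TendstoC1.refl (l := (⊤ : Filter Unit)) hf).eventually_encard_eq hm hs hst ht H).exists.choose_spec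

/-- The number of zeros in a short interval is stable if the endpoints are not zeros. -/
lemma TendstoC1.exists_encard_eq_of_short (hf : IsSimple f f') (hh : TendstoC1 l h h' f f')
    {m s t : ℝ} (hm : 0 < m) (hs : 0 ≤ s) (hst : s < t) (ht : t ≤ 1)
    (H : (∀ x ∈ Icc s t, m ≤ f' x) ∨ (∀ x ∈ Icc s t, f' x ≤ -m) ∨ (∀ x ∈ Icc s t, m ≤ |f x|))
    (hfs : f s ≠ 0) (hft : f t ≠ 0) :
    ∃ n : ℕ, (zeroSet f s t).encard = n ∧ ∀ᶠ i in l, (zeroSet (h i) s t).encard = n := by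
  refine ⟨if f s * f t < 0 then 1 else 0, ?_, ?_⟩
  · rw [hf.encard_eq hm hs hst ht H]
    split_ifs <;> rfl
  · filter_upwards [hh.eventually_encard_eq hm hs hst ht H,
      ((hh.tendsto ⟨hs, hst.le.trans ht⟩).mul (hh.tendsto ⟨hs.trans hst.le, ht⟩)).eventually_neg_iff
        (mul_ne_zero hfs hft)] with i hi hi'
    rw [hi]
    simp only [hi']
    split_ifs <;> rfl

/-- Among two points of a short interval at least one is not a zero. -/
lemma IsSimple.exists_ne_zero (hf : IsSimple f f') {m s t : ℝ} (hm : 0 < m)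
    (hs : 0 ≤ s) (hst : s < t) (ht : t ≤ 1)
    (H : (∀ x ∈ Icc s t, m ≤ f' x) ∨ (∀ x ∈ Icc s t, f' x ≤ -m) ∨ (∀ x ∈ Icc s t, m ≤ |f x|)) :
    ∃ x ∈ Ioo s t, f x ≠ 0 := by
  by_contra! hx
  have h0 : zeroSet f s t = Ioo s t := Subset.antisymm (fun x hx => hx.1) fun x hx' => ⟨hx', hx x hx'⟩
  have h1 := hf.encard_eq hm hs hst ht H
  rw [h0, (Ioo_infinite hst).encard_eq] at h1
  split_ifs at h1 <;> simp at h1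

lemma TendstoC1.exists_encard_eq (hf : IsSimple f f') (hh : TendstoC1 l h h' f f') {t : ℝ}
    (ht : t ∈ Ioc (0 : ℝ) 1) (hft : f t ≠ 0) :
    ∃ n : ℕ, (zeroSet f 0 t).encard = n ∧ ∀ᶠ i in l, (zeroSet (h i) 0 t).encard = n := by
  obtain ⟨r, hr, -, m, hm, H⟩ := hf.exists_short
  have key : ∀ k : ℕ, ∀ t ∈ Ioc (0 : ℝ) 1, t ≤ k * (r / 2) → f t ≠ 0 →
      ∃ n : ℕ, (zeroSet f 0 t).encard = n ∧ ∀ᶠ i in l, (zeroSet (h i) 0 t).encard = n := by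
    intro k
    induction k with
    | zero =>
      intro t ht htk
      simp only [Nat.cast_zero, zero_mul] at htk
      exact absurd ht.1 htk.not_gt
    | succ k ih =>
      intro t ht htk hft
      rcases le_or_gt t r with htr | htr
      · exact hh.exists_encard_eq_of_short hf hm le_rfl ht.1 ht.2
          (H 0 t le_rfl ht.1.le ht.2 (by linarith)) hf.zero hft
      · obtain ⟨s, hs, hfs⟩ := hf.exists_ne_zero hm (s := t - r) (t := t - r / 2) (by linarith)
          (by linarith) (by linarith [ht.2]) (H _ _ (by linarith) (by linarith) (by linarith [ht.2])
          (by linarith))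
        have hs0 : 0 < s := by linarith [hs.1]
        have hst : s < t := by linarith [hs.2]
        push_cast at htk
        obtain ⟨n₁, h₁, h₁'⟩ := ih s ⟨hs0, by linarith [ht.2]⟩ (by linarith [hs.2]) hfs
        obtain ⟨n₂, h₂, h₂'⟩ := hh.exists_encard_eq_of_short hf hm hs0.le hst ht.2
          (H s t hs0.le hst.le ht.2 (by linarith [hs.1])) hfs hft
        refine ⟨n₁ + n₂, by rw [encard_zeroSet_add hs0 hst hfs, h₁, h₂, Nat.cast_add], ?_⟩
        filter_upwards [h₁', h₂', (hh.tendsto ⟨hs0.le, hst.le.trans ht.2⟩).eventually_ne hfs]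
          with i e₁ e₂ hi
        rw [encard_zeroSet_add hs0 hst hi, e₁, e₂, Nat.cast_add]
  obtain ⟨k, hk⟩ := exists_nat_ge (t / (r / 2))
  exact key k t ht ((div_le_iff₀ (half_pos hr)).1 hk) hft

/-- The number of zeros in `(0,1)` when `1` is a zero of the limit. -/
lemma TendstoC1.exists_encard_eq_of_eq_zero (hf : IsSimple f f') (hh : TendstoC1 l h h' f f')
    (hf1 : f 1 = 0) :
    ∃ n : ℕ, (zeroSet f 0 1).encard = n ∧ ∀ᶠ i in l,
      (zeroSet (h i) 0 1).encard = n + if 0 < h i 1 * f' 1 then 1 else 0 := by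
  obtain ⟨r, hr, hr1, m, hm, H⟩ := hf.exists_short
  have H1 := H (1 - r) 1 (by linarith) (by linarith) le_rfl (by linarith)
  obtain ⟨s, hs, hfs⟩ := hf.exists_ne_zero hm (by linarith) (by linarith) le_rfl H1
  have hs0 : 0 < s := by linarith [hs.1]
  have Hs := H s 1 hs0.le hs.2.le le_rfl (by linarith [hs.1])
  have h1m : (1 : ℝ) ∈ Icc s 1 := right_mem_Icc.2 hs.2.le
  have hsm : s ∈ Icc s 1 := left_mem_Icc.2 hs.2.le
  have hsign : f s * f' 1 < 0 := by
    have hsub : Icc s 1 ⊆ Icc (0 : ℝ) 1 := Icc_subset_Icc hs0.le le_rfl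
    have hd : ∀ x ∈ Icc s 1, HasDerivWithinAt f (f' x) (Icc s 1) x :=
      fun x hx => (hf.deriv x (hsub hx)).mono hsub
    rcases Hs with Hs | Hs | Hs
    · have h2 := add_mul_le_of_le_hasDerivWithinAt hs.2.le hd Hs
      have h3 := mul_pos hm (sub_pos.2 hs.2)
      exact mul_neg_of_neg_of_pos (by linarith) (hm.trans_le (Hs 1 h1m))
    · have h2 := add_mul_le_of_le_hasDerivWithinAt (f := -f) (f' := -f') (k := m) hs.2.le
        (fun x hx => (hd x hx).neg) (fun x hx => by simpa using neg_le_neg (Hs x hx))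
      have h3 := mul_pos hm (sub_pos.2 hs.2)
      simp only [Pi.neg_apply] at h2
      exact mul_neg_of_pos_of_neg (by linarith) (by linarith [Hs 1 h1m])
    · have := Hs 1 h1m
      rw [hf1, abs_zero] at this
      linarith
  obtain ⟨n, hn, hn'⟩ := hh.exists_encard_eq hf ⟨hs0, hs.2.le⟩ hfs
  refine ⟨n, ?_, ?_⟩
  · rw [encard_zeroSet_add hs0 hs.2 hfs, hn, hf.encard_eq hm hs0.le hs.2 le_rfl Hs, hf1, mul_zero,
      if_neg (lt_irrefl _), add_zero]
  · have hts := hh.tendsto ⟨hs0.le, hs.2.le⟩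
    filter_upwards [hn', hts.eventually_ne hfs, hh.eventually_encard_eq hm hs0.le hs.2 le_rfl Hs,
      (hts.mul_const (f' 1)).eventually_neg_iff hsign.ne] with i e₁ hi e₂ hi'
    rw [encard_zeroSet_add hs0 hs.2 hi, e₁, e₂]
    have hneg := hi'.2 hsign
    congr 2
    rcases mul_neg_iff.1 hneg with ⟨a, b⟩ | ⟨a, b⟩
    · rw [mul_comm (h i 1), eq_iff_iff, mul_neg_iff, mul_pos_iff]
      simp [a, b, a.not_gt, b.not_gt]
    · rw [mul_comm (h i 1), eq_iff_iff, mul_neg_iff, mul_pos_iff]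
      simp [a, b, a.not_gt, b.not_gt]

end Stability

/-! ### Counting eigenvalues by zeros -/

namespace IsShooting

variable {P : ℝ → ℝ} {α β : ℝ} {Y : ℝ → Fin 4 → ℝ → ℝ}

lemma isSimple (hP : IsWeight P) (hα : 0 ≤ α) (hβ : 0 < β) (hY : IsShooting P α β Y) {μ : ℝ}
    (hμ : 0 ≤ μ) : IsSimple (Y μ 0) (Y μ 1) where
  deriv := (hY.beam μ).1
  cont := (hY.beam μ).continuousOn_one
  zero := by simp [hY.one]
  simple x hx h0 h1 := by
    rcases hx.1.eq_or_lt with rfl | hx0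
    · rw [hY.one] at h0
      exact one_ne_zero h0
    · exact (hY.beam μ).not_double_zero hP hα hβ hμ (hY.left μ) (hY.right μ hμ) (by simp [hY.one])
        ⟨hx0, hx.2⟩ h0 h1

lemma tendstoC1 (hY : IsShooting P α β Y) {μ : ℝ} (hμ : 0 ≤ μ) :
    TendstoC1 (nhds μ) (fun ν => Y ν 0) (fun ν => Y ν 1) (Y μ 0) (Y μ 1) where
  deriv ν := (hY.beam ν).1
  close ε hε := by
    obtain ⟨M, hM, hY⟩ := hY.cont μ hμ
    filter_upwards [hM.eventually (gt_mem_nhds hε)] with ν hν x hx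
    exact ⟨(hY ν x hx 0).trans_lt hν, (hY ν x hx 1).trans_lt hν⟩

end IsShooting

open Classical in
/-- The number of zeros in `(0,1)`, corrected according to the behaviour at the right endpoint. -/
noncomputable def zeroIndex (α β : ℝ) (y : Fin 4 → ℝ → ℝ) : ℕ∞ :=
  (zeroSet (y 0) 0 1).encard + if y 0 1 = 0 ∨ 0 < gForm α β y * y 0 1 then 1 else 0

namespace IsShooting

variable {P : ℝ → ℝ} {α β : ℝ} {Y : ℝ → Fin 4 → ℝ → ℝ}

lemma eventually_zeroIndex_of_eq_zero (hP : IsWeight P) (hα : 0 ≤ α) (hβ : 0 < β)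
    (hY : IsShooting P α β Y) {μ₀ : ℝ} (hμ₀ : 0 ≤ μ₀) (h1 : Y μ₀ 0 1 = 0) :
    zeroIndex α β (Y μ₀) ≠ ⊤ ∧ gForm α β (Y μ₀) ≠ 0 ∧ ∀ᶠ μ in nhds μ₀, 0 ≤ μ → μ ≠ μ₀ →
      gForm α β (Y μ) ≠ 0 ∧ zeroIndex α β (Y μ) = zeroIndex α β (Y μ₀) := by
  have hGz := (hY.beam μ₀).gForm_mul_neg hP hα hβ hμ₀ (hY.left μ₀) (hY.right μ₀ hμ₀)
    (by simp [hY.one]) h1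
  have hG0 : gForm α β (Y μ₀) ≠ 0 := left_ne_zero_of_mul hGz.ne
  obtain ⟨n, hn, hn'⟩ := (hY.tendstoC1 hμ₀).exists_encard_eq_of_eq_zero
    (hY.isSimple hP hα hβ hμ₀) h1
  have hindex : zeroIndex α β (Y μ₀) = n + 1 := by rw [zeroIndex, hn, if_pos (Or.inl h1)]
  have hGG : ∀ᶠ μ in nhds μ₀, 0 < gForm α β (Y μ) * gForm α β (Y μ₀) :=
    (((hY.cont μ₀ hμ₀).continuousAt_gForm α β).tendsto.mul_const _).eventually
      (lt_mem_nhds (mul_self_pos.2 hG0))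
  refine ⟨by rw [hindex]; exact_mod_cast ENat.natCast_ne_top (n + 1), hG0, ?_⟩
  filter_upwards [hn', hGG, hY.eventually_lagrange_pos hP hβ hμ₀] with μ hcount hG hS hμ hne
  have hS := hS hμ hne
  rw [h1, zero_mul, zero_sub] at hS
  refine ⟨left_ne_zero_of_mul hG.ne', ?_⟩
  rw [hindex, zeroIndex, hcount]
  rcases div_pos_iff.1 hS with ⟨hS, -⟩ | ⟨hS, -⟩
  · have hy1 : Y μ 0 1 ≠ 0 := left_ne_zero_of_mul (neg_pos.1 hS).ne
    rw [if_pos, if_neg, add_zero]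
    · rintro (h | h)
      · exact hy1 h
      · nlinarith [mul_pos hG h, mul_self_pos.2 (left_ne_zero_of_mul hG.ne')]
    · have hsq := mul_self_pos.2 hG0
      have := mul_pos (neg_pos.2 hGz) hS
      exact pos_of_mul_pos_right (by nlinarith : 0 < gForm α β (Y μ₀) * gForm α β (Y μ₀) *
        (Y μ 0 1 * Y μ₀ 1 1)) hsq.le
  · have hS : 0 < Y μ 0 1 * gForm α β (Y μ₀) := by linarith
    have hsq := mul_self_pos.2 hG0
    rw [if_neg, if_pos, add_zero]
    · refine Or.inr (pos_of_mul_pos_right (?_ : 0 < gForm α β (Y μ₀) * gForm α β (Y μ₀) *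
        (gForm α β (Y μ) * Y μ 0 1)) hsq.le)
      nlinarith [mul_pos hG hS]
    · intro h
      nlinarith [mul_pos (neg_pos.2 hGz) hS, mul_pos hsq h]

open Classical in
lemma eventually_zeroIndex_of_ne_zero (hP : IsWeight P) (hα : 0 ≤ α) (hβ : 0 < β)
    (hY : IsShooting P α β Y) {μ₀ : ℝ} (hμ₀ : 0 ≤ μ₀) (h1 : Y μ₀ 0 1 ≠ 0) :
    zeroIndex α β (Y μ₀) ≠ ⊤ ∧ ∀ᶠ μ in nhds μ₀, 0 ≤ μ → μ ≠ μ₀ →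
      gForm α β (Y μ) ≠ 0 ∧ zeroIndex α β (Y μ) =
        zeroIndex α β (Y μ₀) + if μ₀ < μ ∧ gForm α β (Y μ₀) = 0 then 1 else 0 := by
  have h1m : (1 : ℝ) ∈ Icc (0 : ℝ) 1 := right_mem_Icc.2 zero_le_one
  obtain ⟨n, hn, hn'⟩ := (hY.tendstoC1 hμ₀).exists_encard_eq
    (hY.isSimple hP hα hβ hμ₀) ⟨zero_lt_one, le_rfl⟩ h1
  have hy1 : Tendsto (fun μ => Y μ 0 1) (nhds μ₀) (nhds (Y μ₀ 0 1)) :=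
    ((hY.cont μ₀ hμ₀).continuousAt 0 h1m).tendsto
  refine ⟨?_, ?_⟩
  · rw [zeroIndex, hn]
    split_ifs
    · exact_mod_cast ENat.natCast_ne_top (n + 1)
    · simp
  by_cases hG0 : gForm α β (Y μ₀) = 0
  · have hyy : ∀ᶠ μ in nhds μ₀, 0 < Y μ 0 1 * Y μ₀ 0 1 :=
      (hy1.mul_const _).eventually (lt_mem_nhds (mul_self_pos.2 h1))
    filter_upwards [hn', hyy, hY.eventually_lagrange_pos hP hβ hμ₀] with μ hcount hy hS hμ hne
    have hS := hS hμ hne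
    have hsq := mul_self_pos.2 h1
    rw [hG0, mul_zero, sub_zero] at hS
    rw [zeroIndex, zeroIndex, hn, hcount]
    rcases div_pos_iff.1 hS with ⟨hS, hlt⟩ | ⟨hS, hlt⟩
    · refine ⟨right_ne_zero_of_mul hS.ne', ?_⟩
      rw [if_pos, if_neg, if_pos ⟨sub_pos.1 hlt, hG0⟩, add_zero]
      · simp [h1, hG0]
      · refine Or.inr (pos_of_mul_pos_right (?_ : 0 < Y μ₀ 0 1 * Y μ₀ 0 1 *
          (gForm α β (Y μ) * Y μ 0 1)) hsq.le)
        nlinarith [mul_pos hy hS]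
    · refine ⟨right_ne_zero_of_mul hS.ne, ?_⟩
      rw [if_neg, if_neg, if_neg, add_zero, add_zero]
      · exact fun h => by linarith [h.1]
      · simp [h1, hG0]
      · rintro (h | h)
        · exact (left_ne_zero_of_mul hy.ne') h
        · nlinarith [mul_pos hsq h, mul_pos hy (neg_pos.2 hS)]
  · have hG := ((hY.cont μ₀ hμ₀).continuousAt_gForm α β).tendsto
    filter_upwards [hn', hy1.eventually_ne h1, hG.eventually_ne hG0,
      (hG.mul hy1).neg.eventually_neg_iff (neg_ne_zero.2 (mul_ne_zero hG0 h1))]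
      with μ hcount hy hGy hiff hμ hne
    refine ⟨hGy, ?_⟩
    simp only [neg_neg_iff_pos] at hiff
    simp [zeroIndex, hn, hcount, hG0, h1, hy, hiff]

open Classical in
lemma encard_eq_zeroIndex (hP : IsWeight P) (hα : 0 ≤ α) (hβ : 0 < β) (hY : IsShooting P α β Y)
    {μ : ℝ} (hμ : 0 ≤ μ) :
    zeroIndex α β (Y μ) ≠ ⊤ ∧
      {ν | 0 ≤ ν ∧ ν < μ ∧ gForm α β (Y ν) = 0}.encard = zeroIndex α β (Y μ) := by
  have hstep : ∀ μ₀, 0 ≤ μ₀ → zeroIndex α β (Y μ₀) ≠ ⊤ ∧ ∀ᶠ μ in nhds μ₀, 0 ≤ μ → μ ≠ μ₀ →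
      gForm α β (Y μ) ≠ 0 ∧ zeroIndex α β (Y μ) =
        zeroIndex α β (Y μ₀) + if μ₀ < μ ∧ gForm α β (Y μ₀) = 0 then 1 else 0 := by
    intro μ₀ hμ₀
    by_cases h1 : Y μ₀ 0 1 = 0
    · obtain ⟨a, b, c⟩ := hY.eventually_zeroIndex_of_eq_zero hP hα hβ hμ₀ h1
      exact ⟨a, by simpa [b] using c⟩
    · exact hY.eventually_zeroIndex_of_ne_zero hP hα hβ hμ₀ h1
  refine ⟨(hstep μ hμ).1, ?_⟩
  set E : ℝ → Set ℝ := fun μ => {ν | 0 ≤ ν ∧ ν < μ ∧ gForm α β (Y ν) = 0} with hE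
  set p : Ici (0 : ℝ) → Prop := fun μ => (E μ).encard = zeroIndex α β (Y μ) with hp
  have hloc : IsLocallyConstant p := by
    refine (IsLocallyConstant.iff_eventually_eq p).2 ?_
    rintro ⟨μ₀, hμ₀⟩
    obtain ⟨l, u, hlu, hsub⟩ := mem_nhds_iff_exists_Ioo_subset.1 (hstep μ₀ hμ₀).2
    rw [nhds_subtype_eq_comap]
    filter_upwards [preimage_mem_comap (Ioo_mem_nhds hlu.1 hlu.2)]
    rintro ⟨μ, hμ⟩ hμlu
    rcases eq_or_ne μ μ₀ with rfl | hne
    · rfl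
    have hT := (hsub hμlu hμ hne).2
    have hEE : (E μ).encard =
        (E μ₀).encard + if μ₀ < μ ∧ gForm α β (Y μ₀) = 0 then 1 else 0 := by
      rcases lt_or_gt_of_ne hne with hlt | hlt
      · rw [if_neg (fun h => hlt.not_gt h.1), add_zero]
        congr 1
        ext ν
        refine ⟨fun h => ⟨h.1, h.2.1.trans hlt, h.2.2⟩, fun h => ⟨h.1, ?_, h.2.2⟩⟩
        by_contra! hle
        exact (hsub ⟨hμlu.1.trans_le hle, h.2.1.trans hlu.2⟩ h.1 h.2.1.ne).1 h.2.2
      · have hcases : ∀ ν ∈ E μ, ν < μ₀ ∨ ν = μ₀ := by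
          intro ν h
          by_contra! hle
          have hlt' := lt_of_le_of_ne hle.1 hle.2.symm
          exact (hsub ⟨hlu.1.trans hlt', h.2.1.trans hμlu.2⟩ h.1 hle.2).1 h.2.2
        by_cases hG : gForm α β (Y μ₀) = 0
        · rw [if_pos ⟨hlt, hG⟩, ← encard_insert_of_notMem (a := μ₀) (fun h => lt_irrefl _ h.2.1)]
          congr 1
          ext ν
          constructor
          · intro h
            rcases hcases ν h with h' | h'
            · exact Or.inr ⟨h.1, h', h.2.2⟩
            · exact Or.inl h'
          · rintro (rfl | h)
            · exact ⟨hμ₀, hlt, hG⟩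
            · exact ⟨h.1, h.2.1.trans hlt, h.2.2⟩
        · rw [if_neg (fun h => hG h.2), add_zero]
          congr 1
          ext ν
          refine ⟨fun h => ⟨h.1, ?_, h.2.2⟩, fun h => ⟨h.1, h.2.1.trans hlt, h.2.2⟩⟩
          refine (hcases ν h).resolve_right ?_
          rintro rfl
          exact hG h.2.2
    simp only [hp, hEE, hT, eq_iff_iff]
    exact (ENat.add_left_injective_of_ne_top (by split_ifs <;> simp)).eq_iff
  have : PreconnectedSpace (Ici (0 : ℝ)) := Subtype.preconnectedSpace isPreconnected_Ici
  have h0 : p ⟨0, self_mem_Ici⟩ := by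
    obtain ⟨hpos, hG⟩ := hY.pos_zero hP hα hβ
    have h1 := hpos 1 (right_mem_Icc.2 zero_le_one)
    have hE0 : E 0 = ∅ := eq_empty_of_forall_notMem fun ν h => h.2.1.not_ge h.1
    have hZ : zeroSet (Y 0 0) 0 1 = ∅ := eq_empty_of_forall_notMem fun x hx =>
      (hpos x (Ioo_subset_Icc_self hx.1)).ne' hx.2
    simp only [hp, zeroIndex, hE0, hZ, encard_empty, zero_add]
    rw [if_neg]
    rintro (h | h)
    · exact h1.ne' h
    · nlinarith
  exact (hloc.apply_eq_of_preconnectedSpace ⟨μ, hμ⟩ ⟨0, self_mem_Ici⟩).mpr h0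

end IsShooting

theorem stmt9 (P : ℝ → ℝ) (κ : ℕ) (a : ℝ) (hP : CantorSelfSimilar P κ a)
    (α β : ℝ) (hα : 0 ≤ α) (hβ : 0 < β)
    (lam : ℝ) (y : ℝ → ℝ) (hy : Eigenfunction P α β lam y) :
    {μ : ℝ | IsEigenvalue P α β μ ∧ μ < lam}.Finite ∧
    {x ∈ Set.Ioo (0:ℝ) 1 | y x = 0}.Finite ∧
    {μ : ℝ | IsEigenvalue P α β μ ∧ μ < lam}.ncard =
      {x ∈ Set.Ioo (0:ℝ) 1 | y x = 0}.ncard := by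
  have hW := hP.isWeight
  obtain ⟨Y, hY⟩ := exists_isShooting hW hα hβ
  have hlam := hy.nonneg hW hβ
  obtain ⟨h0, hmul, hG⟩ := hY.exists_eq_mul hW hα hβ hy
  obtain ⟨hfin, hcount⟩ := hY.encard_eq_zeroIndex hW hα hβ hlam
  have hE : {μ : ℝ | IsEigenvalue P α β μ ∧ μ < lam} =
      {ν | 0 ≤ ν ∧ ν < lam ∧ gForm α β (Y ν) = 0} := by
    ext μ
    simp only [mem_ofPred_eq, hY.isEigenvalue_iff hW hα hβ]
    tauto
  have hZ : {x ∈ Set.Ioo (0:ℝ) 1 | y x = 0} = zeroSet (Y lam 0) 0 1 := by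
    ext x
    refine and_congr_right fun hx => ?_
    rw [hmul x (Ioo_subset_Icc_self hx), mul_eq_zero, or_iff_right h0]
  have h1 : Y lam 0 1 ≠ 0 := fun h1 => by
    have := (hY.beam lam).gForm_mul_neg hW hα hβ hlam (hY.left lam) (hY.right lam hlam)
      (by simp [hY.one]) h1
    rw [hG, zero_mul] at this
    exact lt_irrefl _ this
  have hindex : zeroIndex α β (Y lam) = (zeroSet (Y lam 0) 0 1).encard := by
    simp [zeroIndex, hG, h1]
  rw [hindex] at hfin hcount
  rw [hE, hZ]
  exact ⟨encard_ne_top_iff.1 (hcount ▸ hfin), encard_ne_top_iff.1 hfin, congrArg ENat.toNat hcount⟩
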